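/- arXiv:0802.2938 — 4 statements merged into one kernel-verified Lean document; each statement's English description precedes it below -/
import Mathlib

section
/- For an integer lattice A ⊆ ℤ^n (a subgroup of ℤ^n), let H_A = {x ∈ 𝔾_m^n : x^a = 1 for all a ∈ A}, where x^a = x_1^{a_1} ⋯ x_n^{a_n}. Then the map A ↦ H_A is a bijection between the subgroups of ℤ^n and the algebraic subgroups of 𝔾_m^n (the Zariski closed subgroups of 𝔾_m^n). -/
open MvPolynomial

/-- A Zariski closed subset of the torus `𝔾_m^n`: the common zero set in the torus of
a family of polynomials. -/
def IsTorusClosed (n : ℕ) (S : Set (Fin n → ℂ)) : Prop :=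
  ∃ I : Set (MvPolynomial (Fin n) ℂ),
    S = {x | (∀ j, x j ≠ 0) ∧ ∀ f ∈ I, eval x f = 0}

/-- An algebraic subgroup of `𝔾_m^n`: a Zariski closed subset of the torus that is a
subgroup under coordinatewise multiplication. -/
def IsAlgSubgroup (n : ℕ) (H : Set (Fin n → ℂ)) : Prop :=
  IsTorusClosed n H ∧ (1 : Fin n → ℂ) ∈ H ∧
    (∀ x ∈ H, ∀ y ∈ H, x * y ∈ H) ∧ (∀ x ∈ H, x⁻¹ ∈ H)

/-- For an integer lattice (subgroup) `A ⊆ ℤ^n`, the subgroup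
`H_A = {x ∈ 𝔾_m^n : x^a = 1 for all a ∈ A}` of the torus. -/
def latticeSubgroup (n : ℕ) (A : AddSubgroup (Fin n → ℤ)) : Set (Fin n → ℂ) :=
  {x | (∀ j, x j ≠ 0) ∧ ∀ a ∈ A, ∏ j, x j ^ a j = 1}

theorem ls_alg (n : ℕ) (A : AddSubgroup (Fin n → ℤ)) : IsAlgSubgroup n (latticeSubgroup n A) := by
  refine ⟨⟨{f | ∃ a ∈ A, f = ∏ j, X j ^ (a j).toNat - ∏ j, X j ^ (-(a j)).toNat}, ?_⟩, ?_, ?_, ?_⟩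
  · ext x
    simp only [latticeSubgroup, Set.mem_setOf_eq]
    refine and_congr_right fun hx => ?_
    have key : ∀ a : Fin n → ℤ, eval x (∏ j, X j ^ (a j).toNat - ∏ j, X j ^ (-(a j)).toNat) = 0 ↔
        ∏ j, x j ^ a j = 1 := by
      intro a
      have h1 : ∏ j, x j ^ a j = (∏ j, x j ^ (a j).toNat) / ∏ j, x j ^ (-(a j)).toNat := by
        rw [← Finset.prod_div_distrib]
        refine Finset.prod_congr rfl fun j _ => ?_
        rw [← zpow_natCast, ← zpow_natCast, ← zpow_sub₀ (hx j)]
        congr 1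
        omega
      have h2 : ∏ j, x j ^ (-(a j)).toNat ≠ 0 :=
        Finset.prod_ne_zero_iff.2 fun j _ => pow_ne_zero _ (hx j)
      rw [h1, div_eq_one_iff_eq h2]
      simp [sub_eq_zero]
    constructor
    · rintro h f ⟨a, ha, rfl⟩
      exact (key a).2 (h a ha)
    · intro h a ha
      exact (key a).1 (h _ ⟨a, ha, rfl⟩)
  · simp [latticeSubgroup]
  · rintro x ⟨hx, hx'⟩ y ⟨hy, hy'⟩
    refine ⟨fun j => mul_ne_zero (hx j) (hy j), fun a ha => ?_⟩
    simp [mul_zpow, Finset.prod_mul_distrib, hx' a ha, hy' a ha]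
  · rintro x ⟨hx, hx'⟩
    refine ⟨fun j => inv_ne_zero (hx j), fun a ha => ?_⟩
    simp [inv_zpow, hx' a ha]

theorem exists_expHom : ∃ e : AddCircle (1 : ℚ) →+ Additive ℂˣ, Function.Injective e := by
  let g : Multiplicative ℚ →* ℂ :=
    { toFun := fun q => Complex.exp (2 * Real.pi * Complex.I * ((Multiplicative.toAdd q : ℚ) : ℂ))
      map_one' := by simp
      map_mul' := fun a b => by
        rw [← Complex.exp_add]; congr 1; simp only [toAdd_mul]; push_cast; ring }
  let g' : ℚ →+ Additive ℂˣ := MonoidHom.toAdditiveRight g.toHomUnits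
  have hg : ∀ q, g' q = 0 ↔ q ∈ AddSubgroup.zmultiples (1 : ℚ) := by
    intro q
    have : g' q = 0 ↔ Complex.exp (2 * Real.pi * Complex.I * (q : ℂ)) = 1 := by
      change g.toHomUnits (Multiplicative.ofAdd q) = 1 ↔ _
      rw [Units.ext_iff]
      rfl
    rw [this, Complex.exp_eq_one_iff, AddSubgroup.mem_zmultiples_iff]
    refine exists_congr fun k => ?_
    have h0 := Complex.two_pi_I_ne_zero
    rw [mul_comm, mul_left_inj' h0]
    constructor
    · intro h
      have : q = k := by exact_mod_cast h
      simp [this]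
    · intro h
      simp [← h]
  refine ⟨QuotientAddGroup.lift _ g' fun q hq => (hg q).2 hq, ?_⟩
  rw [injective_iff_map_eq_zero]
  intro x
  induction x using QuotientAddGroup.induction_on with
  | H q =>
    intro h
    exact (QuotientAddGroup.eq_zero_iff q).2 ((hg q).1 h)

theorem ls_sep (n : ℕ) (A : AddSubgroup (Fin n → ℤ)) (b : Fin n → ℤ) (hb : b ∉ A) :
    ∃ x ∈ latticeSubgroup n A, ∏ j, x j ^ b j ≠ 1 := by
  obtain ⟨e, he⟩ := exists_expHom
  have hb' : (b : (Fin n → ℤ) ⧸ A) ≠ 0 := fun h => hb ((QuotientAddGroup.eq_zero_iff b).1 h)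
  obtain ⟨c, hc⟩ := CharacterModule.exists_character_apply_ne_zero_of_ne_zero hb'
  let φ : (Fin n → ℤ) →+ Additive ℂˣ :=
    (e.comp (c : ((Fin n → ℤ) ⧸ A) →+ AddCircle (1 : ℚ))).comp (QuotientAddGroup.mk' A)
  let x : Fin n → ℂ := fun j => ((φ (Pi.single j 1)).toMul : ℂˣ)
  have key : ∀ a : Fin n → ℤ, ∏ j, x j ^ a j = ((φ a).toMul : ℂˣ) := by
    intro a
    have h1 : a = ∑ j, a j • Pi.single j (1 : ℤ) := by
      ext i
      simp [Finset.sum_apply, Pi.single_apply]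
    conv_rhs => rw [h1, map_sum]
    simp only [map_zsmul]
    simp [x, toMul_sum]
  refine ⟨x, ⟨fun j => Units.ne_zero _, fun a ha => ?_⟩, ?_⟩
  · rw [key]
    have : φ a = 0 := by
      have : (QuotientAddGroup.mk' A) a = 0 := (QuotientAddGroup.eq_zero_iff a).2 ha
      simp only [φ, AddMonoidHom.comp_apply, this, map_zero]
    simp [this]
  · rw [key]
    intro h
    apply hc
    apply he
    rw [map_zero]
    have h2 : (φ b).toMul = 1 := Units.ext h
    exact h2

theorem ls_surj (n : ℕ) (H : Set (Fin n → ℂ)) (hH : IsAlgSubgroup n H) :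
    ∃ A : AddSubgroup (Fin n → ℤ), latticeSubgroup n A = H := by
  classical
  obtain ⟨⟨I, hI⟩, h1, hmul, -⟩ := hH
  have hne : ∀ x ∈ H, ∀ j, x j ≠ 0 := fun x hx => by rw [hI] at hx; exact hx.1
  let A : AddSubgroup (Fin n → ℤ) :=
    { carrier := {a | ∀ x ∈ H, ∏ j, x j ^ a j = 1}
      zero_mem' := by simp
      add_mem' := by
        intro a b ha hb x hx
        simp [zpow_add₀ (hne x hx _), Finset.prod_mul_distrib, ha x hx, hb x hx]
      neg_mem' := by
        intro a ha x hx
        simp [ha x hx] }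
  refine ⟨A, Set.Subset.antisymm ?_ fun x hx => ⟨hne x hx, fun a ha => ha x hx⟩⟩
  rintro y ⟨hy, hyA⟩
  rw [hI]
  refine ⟨hy, fun f hf => ?_⟩
  let M : Submonoid (Fin n → ℂ) := ⟨⟨H, fun {a b} ha hb => hmul a ha b hb⟩, h1⟩
  let χ : (Fin n →₀ ℕ) → (M →* ℂ) := fun m =>
    { toFun := fun x => ∏ j, x.1 j ^ m j
      map_one' := by simp
      map_mul' := fun a b => by simp [mul_pow, Finset.prod_mul_distrib] }
  let ψ : (Fin n →₀ ℕ) → ℂ := fun m => ∏ j, y j ^ m j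
  have hfac : Function.FactorsThrough ψ χ := by
    intro m m' h
    have hA : (fun j => (m j : ℤ) - m' j) ∈ A := by
      intro x hx
      have h2 : ∏ j, x j ^ m j = ∏ j, x j ^ m' j := DFunLike.congr_fun h (⟨x, hx⟩ : M)
      have h3 : ∏ j, x j ^ m' j ≠ 0 :=
        Finset.prod_ne_zero_iff.2 fun j _ => pow_ne_zero _ (hne x hx j)
      simp only [zpow_sub₀ (hne x hx _), zpow_natCast, Finset.prod_div_distrib, h2]
      exact div_self h3
    have h4 := hyA _ hA
    have h3 : ∏ j, y j ^ m' j ≠ 0 :=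
      Finset.prod_ne_zero_iff.2 fun j _ => pow_ne_zero _ (hy j)
    simp only [zpow_sub₀ (hy _), zpow_natCast, Finset.prod_div_distrib] at h4
    exact (div_eq_one_iff_eq h3).1 h4
  let g : (M →* ℂ) →₀ ℂ := ∑ m ∈ f.support, Finsupp.single (χ m) (coeff m f)
  have hg : g = 0 := by
    apply linearIndependent_iff.1 (linearIndependent_monoidHom M ℂ)
    ext x
    have hx : eval x.1 f = 0 := by
      have := x.2
      change x.1 ∈ H at this
      rw [hI] at this
      exact this.2 f hf
    rw [eval_eq'] at hx
    simp only [g, map_sum, Finsupp.linearCombination_single, Finset.sum_apply, Pi.smul_apply,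
      smul_eq_mul, Pi.zero_apply]
    exact hx
  have h5 : Finsupp.linearCombination ℂ (Function.extend χ ψ 0) g = eval y f := by
    rw [eval_eq']
    simp only [g, map_sum, Finsupp.linearCombination_single, smul_eq_mul, hfac.extend_apply]
    rfl
  rw [← h5, hg, map_zero]

/-- The map `A ↦ H_A` is a bijection between the subgroups of `ℤ^n`
(integer lattices) and the algebraic subgroups of `𝔾_m^n`: it takes values in algebraic
subgroups, is injective, and every algebraic subgroup is of the form `H_A`. -/
theorem lattice_algebraic_subgroup_bijection (n : ℕ) :
    (∀ A : AddSubgroup (Fin n → ℤ), IsAlgSubgroup n (latticeSubgroup n A)) ∧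
    Function.Injective (latticeSubgroup n) ∧
    (∀ H : Set (Fin n → ℂ), IsAlgSubgroup n H →
      ∃ A : AddSubgroup (Fin n → ℤ), latticeSubgroup n A = H) := by

  refine ⟨ls_alg n, ?_, ls_surj n⟩
  have hle : ∀ A B : AddSubgroup (Fin n → ℤ), latticeSubgroup n A = latticeSubgroup n B → B ≤ A := by
    intro A B h b hb
    by_contra hbA
    obtain ⟨x, hx, hne⟩ := ls_sep n A b hbA
    rw [h] at hx
    exact hne (hx.2 b hb)
  intro A B h
  exact le_antisymm (hle B A h.symm) (hle A B h)
end

section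
/- Let f ∈ ℂ[X_1, …, X_n], n ≥ 2, be a nontrivial irreducible polynomial (nontrivial means f is not a constant multiple of a monomial), let M ≥ 1 and let η_1, …, η_n be M-th roots of unity. If f divides the polynomial f(η_1 X_1^N, η_2 X_2^N, …, η_n X_n^N) for some integer N > 1, then f has the form f = c · X^u · (X^a − ζ), i.e. f is a constant or monomial multiple of a binomial X^a − ζ, where a is an integer vector and ζ is a root of unity with ζ^{(N−1)M} = 1. Equivalently, f = c(X^u − ζ X^v) for some nonzero constant c ∈ ℂ, monomials X^u, X^v, and a root of unity ζ with ζ^{(N−1)M} = 1. -/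
open MvPolynomial

/-- The substitution `X_i ↦ θ_i X_i^r`. -/
noncomputable def tw {n : ℕ} (θ : Fin n → ℂ) (r : ℕ) :
    MvPolynomial (Fin n) ℂ →ₐ[ℂ] MvPolynomial (Fin n) ℂ :=
  aeval (fun i => C (θ i) * X i ^ r)

lemma tw_monomial {n : ℕ} (θ : Fin n → ℂ) (r : ℕ) (u : Fin n →₀ ℕ) (a : ℂ) :
    tw θ r (monomial u a) = monomial (r • u) (a * ∏ i, θ i ^ u i) := by
  rw [tw, aeval_monomial, monomial_eq (s := r • u), Finsupp.prod_fintype _ _ (by simp),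
    Finsupp.prod_fintype _ _ (by simp)]
  simp only [mul_pow, Finset.prod_mul_distrib, C_mul, map_prod, C_pow, algebraMap_eq,
    Finsupp.smul_apply, smul_eq_mul, pow_mul, mul_assoc]

lemma tw_comp {n : ℕ} (θ φ : Fin n → ℂ) (r s : ℕ) (f : MvPolynomial (Fin n) ℂ) :
    tw θ r (tw φ s f) = tw (fun i => φ i * θ i ^ s) (r * s) f := by
  rw [← AlgHom.comp_apply]
  congr 1
  apply MvPolynomial.algHom_ext
  intro i
  simp [tw, mul_pow, ← pow_mul, mul_assoc, algHom_C]

lemma coeff_tw {n : ℕ} (θ : Fin n → ℂ) (r : ℕ) (hr : 0 < r) (f : MvPolynomial (Fin n) ℂ)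
    (u : Fin n →₀ ℕ) : coeff (r • u) (tw θ r f) = coeff u f * ∏ i, θ i ^ u i := by
  classical
  induction f using MvPolynomial.induction_on' with
  | monomial v a =>
    rw [tw_monomial, coeff_monomial, coeff_monomial]
    by_cases h : v = u
    · simp [h]
    · rw [if_neg, if_neg h, zero_mul]
      intro h'
      apply h
      ext k
      have := DFunLike.congr_fun h' k
      simp only [Finsupp.smul_apply, smul_eq_mul] at this
      exact Nat.eq_of_mul_eq_mul_left hr this
  | add p q hp hq => simp only [map_add, coeff_add, hp, hq, add_mul]

lemma tw_ne_zero {n : ℕ} (θ : Fin n → ℂ) (hθ : ∀ i, θ i ≠ 0) (r : ℕ) (hr : 0 < r)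
    (f : MvPolynomial (Fin n) ℂ) (hf : f ≠ 0) : tw θ r f ≠ 0 := by
  obtain ⟨u, hu⟩ := MvPolynomial.ne_zero_iff.mp hf
  refine MvPolynomial.ne_zero_iff.mpr ⟨r • u, ?_⟩
  rw [coeff_tw θ r hr]
  exact mul_ne_zero hu (Finset.prod_ne_zero_iff.mpr fun i _ => pow_ne_zero _ (hθ i))

lemma totalDegree_tw_le {n : ℕ} (θ : Fin n → ℂ) (r : ℕ) (f : MvPolynomial (Fin n) ℂ) :
    (tw θ r f).totalDegree ≤ r * f.totalDegree := by
  conv_lhs => rw [f.as_sum, map_sum]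
  apply totalDegree_finsetSum_le
  intro u hu
  rw [tw_monomial]
  refine (totalDegree_monomial_le _ _).trans ?_
  have := le_totalDegree hu
  have h2 : (r • u).sum (fun _ e => e) = r * u.sum (fun _ e => e) := by
    rw [Finsupp.sum_fintype _ _ (by simp), Finsupp.sum_fintype _ _ (by simp), Finset.mul_sum]
    simp
  exact (le_of_eq h2).trans (Nat.mul_le_mul_left _ this)

lemma tw_one {n : ℕ} (f : MvPolynomial (Fin n) ℂ) : tw (fun _ => 1) 1 f = f := by
  simp [tw]

lemma totalDegree_tw_one {n : ℕ} (θ : Fin n → ℂ) (hθ : ∀ i, θ i ≠ 0)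
    (f : MvPolynomial (Fin n) ℂ) : (tw θ 1 f).totalDegree = f.totalDegree := by
  apply le_antisymm
  · simpa using totalDegree_tw_le θ 1 f
  · have h := totalDegree_tw_le (fun i => (θ i)⁻¹) 1 (tw θ 1 f)
    rw [tw_comp] at h
    simpa [hθ, tw_one] using h

lemma irreducible_tw {n : ℕ} (θ : Fin n → ℂ) (hθ : ∀ i, θ i ≠ 0)
    (f : MvPolynomial (Fin n) ℂ) (hf : Irreducible f) : Irreducible (tw θ 1 f) := by
  let e : MvPolynomial (Fin n) ℂ ≃ₐ[ℂ] MvPolynomial (Fin n) ℂ :=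
    AlgEquiv.ofAlgHom (tw θ 1) (tw (fun i => (θ i)⁻¹) 1)
      (AlgHom.ext fun g => by simp [tw_comp, hθ, tw_one])
      (AlgHom.ext fun g => by simp [tw_comp, hθ, tw_one])
  exact (MulEquiv.irreducible_iff e.toMulEquiv).mpr hf

lemma iterate_dvd {n : ℕ} (η : Fin n → ℂ) (hη : ∀ i, η i ≠ 0) (N : ℕ)
    (f : MvPolynomial (Fin n) ℂ) (h : f ∣ tw η N f) (k : ℕ) :
    ∃ θ : Fin n → ℂ, (∀ i, θ i ≠ 0) ∧ f ∣ tw θ (N ^ k) f := by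
  induction k with
  | zero => exact ⟨fun _ => 1, by simp, by simp [tw_one]⟩
  | succ k ih =>
    obtain ⟨θ, h0, hd⟩ := ih
    refine ⟨fun i => θ i * η i ^ (N ^ k), fun i => mul_ne_zero (h0 i) (pow_ne_zero _ (hη i)), ?_⟩
    rw [pow_succ', ← tw_comp]
    exact h.trans (map_dvd (tw η N) hd)

lemma prod_exp {n : ℕ} (ω : ℂ) (i j : Fin n) (p q : ℕ) (u : Fin n →₀ ℕ) :
    ∏ k, (ω ^ ((Pi.single i p + Pi.single j q : Fin n → ℕ) k)) ^ u k = ω ^ (p * u i + q * u j) := by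
  simp only [← pow_mul, Finset.prod_pow_eq_pow_sum]
  congr 1
  simp [add_mul, Finset.sum_add_distrib, Pi.single_apply]

lemma assoc_rel {n : ℕ} (f : MvPolynomial (Fin n) ℂ) (g g' : Fin n → ℂ)
    (h : Associated (tw g 1 f) (tw g' 1 f)) (u v : Fin n →₀ ℕ) (hu : u ∈ f.support)
    (hv : v ∈ f.support) :
    (∏ i, g i ^ u i) * (∏ i, g' i ^ v i) = (∏ i, g' i ^ u i) * (∏ i, g i ^ v i) := by
  obtain ⟨c, hc⟩ := h
  obtain ⟨a, ha, hac⟩ := isUnit_iff_eq_C_of_isReduced.mp c.isUnit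
  rw [hac] at hc
  have key : ∀ w ∈ f.support, (∏ i, g i ^ w i) * a = ∏ i, g' i ^ w i := by
    intro w hw
    have h1 := congrArg (coeff (1 • w)) hc
    rw [mul_comm, coeff_C_mul, coeff_tw _ 1 one_pos, coeff_tw _ 1 one_pos] at h1
    apply mul_left_cancel₀ (mem_support_iff.mp hw)
    rw [← h1]; ring
  rw [← key u hu, ← key v hv]; ring

lemma collinear_support {n : ℕ} (f : MvPolynomial (Fin n) ℂ) (hirr : Irreducible f)
    (η : Fin n → ℂ) (hη : ∀ i, η i ≠ 0) (N : ℕ) (hN : 1 < N) (h : f ∣ tw η N f)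
    (u v w : Fin n →₀ ℕ) (hu : u ∈ f.support) (hv : v ∈ f.support) (hw : w ∈ f.support)
    (i j : Fin n) :
    ((u i : ℤ) - w i) * ((v j : ℤ) - w j) = ((u j : ℤ) - w j) * ((v i : ℤ) - w i) := by
  by_contra hne
  obtain ⟨D, hD⟩ : ∃ D : ℤ, D = ((u i : ℤ) - w i) * ((v j : ℤ) - w j) -
    ((u j : ℤ) - w j) * ((v i : ℤ) - w i) := ⟨_, rfl⟩
  have hD0 : D ≠ 0 := by rw [hD]; exact sub_ne_zero.mpr hne
  set d := D.natAbs with hd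
  have hd0 : 0 < d := Int.natAbs_pos.mpr hD0
  obtain ⟨θ, hθ, hdv⟩ := iterate_dvd η hη N f h (4 * d ^ 2)
  set m := N ^ (4 * d ^ 2) with hm
  have hmgt : 4 * d ^ 2 < m := Nat.lt_pow_self hN
  have hm0 : m ≠ 0 := by omega
  set K := m / d with hK
  have hKd : K * d ≤ m := Nat.div_mul_le_self m d
  have hKm : m < K * K := by
    have h1 : m < (K + 1) * d := by
      have := Nat.lt_div_mul_add (a := m) hd0
      rw [← hK] at this
      linarith
    have h2 : 1 ≤ K := by
      rw [hK]; apply Nat.div_pos _ hd0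
      nlinarith
    have h3 : m < 2 * K * d := by nlinarith
    have h4 : m * m < (2 * K * d) * (2 * K * d) := Nat.mul_self_lt_mul_self h3
    have h5 : (2 * K * d) * (2 * K * d) = (4 * d ^ 2) * (K * K) := by ring
    rw [h5] at h4
    by_contra hcon
    push Not at hcon
    have : (4 * d ^ 2) * (K * K) ≤ m * m := Nat.mul_le_mul hmgt.le hcon
    omega
  have hω := Complex.isPrimitiveRoot_exp m hm0
  set ω := Complex.exp (2 * Real.pi * Complex.I / m) with hωd
  have hω0 : ω ≠ 0 := hω.ne_zero hm0
  let g : ℕ × ℕ → Fin n → ℂ := fun x k => ω ^ ((Pi.single i x.1 + Pi.single j x.2 : Fin n → ℕ) k)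
  have hg0 : ∀ x k, g x k ≠ 0 := fun x k => pow_ne_zero _ hω0
  have hinj : ∀ x ∈ Finset.range K ×ˢ Finset.range K, ∀ y ∈ Finset.range K ×ˢ Finset.range K,
      Associated (tw (g x) 1 f) (tw (g y) 1 f) → x = y := by
    rintro ⟨p, q⟩ hx ⟨p', q'⟩ hy hass
    simp only [Finset.mem_product, Finset.mem_range] at hx hy
    have key : ∀ s ∈ f.support, (m : ℤ) ∣ ((p : ℤ) - p') * ((s i : ℤ) - w i) +
        ((q : ℤ) - q') * ((s j : ℤ) - w j) := by
      intro s hs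
      have h1 := assoc_rel f _ _ hass s w hs hw
      simp only [g, prod_exp] at h1
      rw [← pow_add, ← pow_add] at h1
      apply (hω.zpow_eq_one_iff_dvd _).mp
      have h2 : ((p : ℤ) - p') * ((s i : ℤ) - w i) + ((q : ℤ) - q') * ((s j : ℤ) - w j) =
          ((p * s i + q * s j + (p' * w i + q' * w j) : ℕ) : ℤ) -
            ((p' * s i + q' * s j + (p * w i + q * w j) : ℕ) : ℤ) := by
        push_cast; ring
      rw [h2, zpow_sub₀ hω0, zpow_natCast, zpow_natCast, h1, div_self (pow_ne_zero _ hω0)]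
    have ku := key u hu
    have kv := key v hv
    have small : ∀ a b : ℕ, a < K → b < K → (m : ℤ) ∣ ((a : ℤ) - b) * D → a = b := by
      intro a b ha hb hdvd
      by_contra hab
      have h1 : ((a : ℤ) - b) * D ≠ 0 := mul_ne_zero (by omega) hD0
      have h2 := Int.le_of_dvd (abs_pos.mpr h1) ((dvd_abs _ _).mpr hdvd)
      rw [abs_mul] at h2
      have h3 : |(a : ℤ) - b| + 1 ≤ K := by
        have : |(a : ℤ) - b| < K := abs_lt.mpr (by omega)
        omega
      have h4 : |D| = (d : ℤ) := Int.abs_eq_natAbs D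
      rw [h4] at h2
      have h5 : (K : ℤ) * d ≤ m := by exact_mod_cast hKd
      have h6 : (0 : ℤ) < d := by exact_mod_cast hd0
      nlinarith
    have e1 : p = p' := small p p' hx.1 hy.1 (by
      obtain ⟨a, ha⟩ := ku
      obtain ⟨b, hb⟩ := kv
      refine ⟨a * ((v j : ℤ) - w j) - b * ((u j : ℤ) - w j), ?_⟩
      rw [hD]
      linear_combination ((v j : ℤ) - w j) * ha - ((u j : ℤ) - w j) * hb)
    have e2 : q = q' := small q q' hx.2 hy.2 (by
      obtain ⟨a, ha⟩ := ku
      obtain ⟨b, hb⟩ := kv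
      refine ⟨b * ((u i : ℤ) - w i) - a * ((v i : ℤ) - w i), ?_⟩
      rw [hD]
      linear_combination ((u i : ℤ) - w i) * hb - ((v i : ℤ) - w i) * ha)
    rw [e1, e2]
  have hprod : ∏ x ∈ Finset.range K ×ˢ Finset.range K, tw (g x) 1 f ∣ tw θ m f := by
    apply Finset.prod_dvd_of_isRelPrime
    · intro x hx y hy hxy
      have hxi := irreducible_tw (g x) (hg0 x) f hirr
      have hyi := irreducible_tw (g y) (hg0 y) f hirr
      refine (hxi.isRelPrime_iff_not_dvd).mpr fun hdd => hxy ?_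
      exact hinj x hx y hy (hxi.associated_of_dvd hyi hdd)
    · intro x hx
      have := map_dvd (tw (g x) 1) hdv
      rw [tw_comp] at this
      convert this using 3
      · funext k
        have : g x k ^ m = 1 := by
          simp only [g]
          rw [← pow_mul, mul_comm, pow_mul, hω.pow_eq_one, one_pow]
        simp [this]
      · simp
  have hdeg := totalDegree_le_of_dvd_of_isDomain hprod
    (tw_ne_zero θ hθ m (by omega) f hirr.ne_zero)
  have hpd : ∀ s : Finset (ℕ × ℕ), (∏ x ∈ s, tw (g x) 1 f).totalDegree = s.card * f.totalDegree := by
    classical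
    intro s
    induction s using Finset.induction_on with
    | empty => simp
    | insert a s ha ih =>
      rw [Finset.prod_insert ha, totalDegree_mul_of_isDomain, ih, totalDegree_tw_one _ (hg0 a),
        Finset.card_insert_of_notMem ha]
      · ring
      · exact (irreducible_tw (g a) (hg0 a) f hirr).ne_zero
      · exact Finset.prod_ne_zero_iff.mpr fun x _ => (irreducible_tw (g x) (hg0 x) f hirr).ne_zero
  rw [hpd] at hdeg
  simp only [Finset.card_product, Finset.card_range] at hdeg
  have hfd : 0 < f.totalDegree := by
    rcases Nat.eq_zero_or_pos f.totalDegree with h0 | h0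
    · exfalso
      rw [totalDegree_eq_zero_iff_eq_C] at h0
      apply hirr.not_isUnit
      rw [h0]
      refine IsUnit.map C (isUnit_iff_ne_zero.mpr fun hc => hirr.ne_zero ?_)
      rw [h0, hc, C_0]
    · exact h0
  have := hdeg.trans (totalDegree_tw_le θ m f)
  have := Nat.le_of_mul_le_mul_right this hfd
  omega

/-- Parametrization of a collinear support by a primitive direction. -/
lemma param_support {n : ℕ} (S : Finset (Fin n →₀ ℕ)) (hS : S.Nontrivial)
    (hcol : ∀ u ∈ S, ∀ v ∈ S, ∀ w ∈ S, ∀ i j : Fin n,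
      ((u i : ℤ) - w i) * ((v j : ℤ) - w j) = ((u j : ℤ) - w j) * ((v i : ℤ) - w i)) :
    ∃ (w z : Fin n →₀ ℕ) (d : Fin n → ℤ) (T : ℕ), w ∈ S ∧ z ∈ S ∧ 0 < T ∧ (∃ i, 0 < d i) ∧
      (∀ k, (z k : ℤ) = w k + T * d k) ∧
      ∀ s ∈ S, ∃ t : ℕ, t ≤ T ∧ ∀ k, (s k : ℤ) = w k + t * d k := by
  obtain ⟨x, hx, y, hy, hxy⟩ := hS
  obtain ⟨i, hi⟩ : ∃ i, x i ≠ y i := by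
    by_contra hcon
    push Not at hcon
    exact hxy (Finsupp.ext hcon)
  obtain ⟨w, hw, hwmin⟩ := S.exists_min_image (fun s => s i) ⟨x, hx⟩
  obtain ⟨z, hz, hzmax⟩ := S.exists_max_image (fun s => s i) ⟨x, hx⟩
  have hlt : w i < z i := by
    have := hwmin x hx
    have := hwmin y hy
    have := hzmax x hx
    have := hzmax y hy
    omega
  obtain ⟨d, hd, hd1⟩ := Finset.extract_gcd (s := (Finset.univ : Finset (Fin n)))
    (fun k => (z k : ℤ) - w k) ⟨i, Finset.mem_univ i⟩
  set G := (Finset.univ : Finset (Fin n)).gcd (fun k => (z k : ℤ) - w k) with hG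
  have hG0 : 0 ≤ G := Int.nonneg_of_normalize_eq_self Finset.normalize_gcd
  have hdi := hd i (Finset.mem_univ i)
  have hpos : 0 < G * d i := by rw [← hdi]; omega
  have hGpos : 0 < G := by
    rcases hG0.eq_or_lt with h | h
    · rw [← h] at hpos; simp at hpos
    · exact h
  have hdpos : 0 < d i := pos_of_mul_pos_right hpos hG0
  have hT : (G.toNat : ℤ) = G := Int.toNat_of_nonneg hG0
  refine ⟨w, z, d, G.toNat, hw, hz, by omega, ⟨i, hdpos⟩, ?_, ?_⟩
  · intro k
    rw [hT, ← hd k (Finset.mem_univ k)]; ring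
  · intro s hs
    have key : ∀ k, ((s i : ℤ) - w i) * d k = ((s k : ℤ) - w k) * d i := by
      intro k
      have h1 := hcol s hs z hz w hw i k
      have h2 := hd k (Finset.mem_univ k)
      rw [h2, hdi] at h1
      apply mul_left_cancel₀ hGpos.ne'
      linear_combination h1
    have hdvd : d i ∣ (s i : ℤ) - w i := by
      have h1 : d i ∣ (Finset.univ : Finset (Fin n)).gcd (fun k => ((s i : ℤ) - w i) * d k) :=
        Finset.dvd_gcd fun k _ => by rw [key k]; exact Dvd.intro_left _ rfl
      rw [Finset.gcd_mul_left, hd1, mul_one] at h1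
      exact (dvd_normalize_iff).mp h1
    obtain ⟨t, ht⟩ := hdvd
    have h1 := hwmin s hs
    have h2 := hzmax s hs
    have ht0 : 0 ≤ t := by
      have : 0 ≤ d i * t := by rw [← ht]; omega
      exact nonneg_of_mul_nonneg_right this hdpos
    have htG : t ≤ G := by
      have : d i * t ≤ d i * G := by
        rw [← ht, mul_comm (d i) G, ← hdi]; omega
      exact le_of_mul_le_mul_left this hdpos
    refine ⟨t.toNat, by omega, fun k => ?_⟩
    rw [Int.toNat_of_nonneg ht0]
    have h3 := key k
    rw [ht] at h3
    have : t * d k = (s k : ℤ) - w k := by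
      apply mul_left_cancel₀ hdpos.ne'
      linear_combination h3
    rw [this]; ring

lemma binomial_of_collinear {n : ℕ} (f : MvPolynomial (Fin n) ℂ) (hirr : Irreducible f)
    (hnontriv : ∀ (c : ℂ) (u : Fin n →₀ ℕ), f ≠ monomial u c)
    (hcol : ∀ u ∈ f.support, ∀ v ∈ f.support, ∀ w ∈ f.support, ∀ i j : Fin n,
      ((u i : ℤ) - w i) * ((v j : ℤ) - w j) = ((u j : ℤ) - w j) * ((v i : ℤ) - w i)) :
    ∃ (c : ℂ) (u v : Fin n →₀ ℕ) (ζ : ℂ), c ≠ 0 ∧ ζ ≠ 0 ∧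
      f = C c * (monomial u 1 - C ζ * monomial v 1) := by
  classical
  have hS : f.support.Nontrivial := by
    rw [← Finset.one_lt_card_iff_nontrivial]
    by_contra hcon
    have hne : f.support.Nonempty := by
      rw [Finset.nonempty_iff_ne_empty]; simpa using hirr.ne_zero
    have h1 : f.support.card = 1 := by
      have := hne.card_pos
      omega
    obtain ⟨u, hu⟩ := Finset.card_eq_one.mp h1
    apply hnontriv (coeff u f) u
    conv_lhs => rw [f.as_sum, hu, Finset.sum_singleton]
  obtain ⟨w, z, d, T, hw, hz, hT, ⟨i, hi⟩, hzk, hpar⟩ := param_support f.support hS hcol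
  choose! t htT ht using hpar
  have htinj : ∀ s ∈ f.support, ∀ s' ∈ f.support, t s = t s' → s = s' := by
    intro s hs s' hs' h
    ext k
    have h1 := ht s hs k
    have h2 := ht s' hs' k
    rw [h] at h1
    omega
  have htw : t w = 0 := by
    have h1 := ht w hw i
    have : (t w : ℤ) * d i = 0 := by linarith
    rcases mul_eq_zero.mp this with h | h
    · exact_mod_cast h
    · omega
  have htz : t z = T := by
    have h1 := ht z hz i
    have h2 := hzk i
    have : (t z : ℤ) * d i = T * d i := by linarith
    exact_mod_cast mul_right_cancel₀ hi.ne' this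
  let a : Fin n →₀ ℕ := Finsupp.equivFunOnFinite.symm fun k => (d k).toNat
  let b : Fin n →₀ ℕ := Finsupp.equivFunOnFinite.symm fun k => (-d k).toNat
  let e : Fin n →₀ ℕ := Finsupp.equivFunOnFinite.symm fun k => w k - T * (-d k).toNat
  have hdecomp : ∀ s ∈ f.support, s = e + t s • a + (T - t s) • b := by
    intro s hs
    ext k
    have h1 := ht s hs k
    have h2 := hzk k
    have h3 := htT s hs
    simp only [Finsupp.add_apply, Finsupp.smul_apply, smul_eq_mul, a, b, e,
      Finsupp.equivFunOnFinite_symm_apply_apply]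
    obtain ⟨r, hr | hr⟩ := Int.eq_nat_or_neg (d k)
    · rw [hr] at h1
      have : (-d k).toNat = 0 := by omega
      rw [this]
      have : (d k).toNat = r := by omega
      rw [this]
      simp only [mul_zero, add_zero, Nat.sub_zero]
      exact_mod_cast h1
    · rw [hr] at h1 h2
      have : (-d k).toNat = r := by omega
      rw [this]
      have : (d k).toNat = 0 := by omega
      rw [this]
      have h4 : T * r ≤ w k := by
        zify; nlinarith [Int.natCast_nonneg (z k)]
      zify [h3, h4]
      rw [h1]; ring
  let A : MvPolynomial (Fin n) ℂ := monomial a 1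
  let B : MvPolynomial (Fin n) ℂ := monomial b 1
  let E : MvPolynomial (Fin n) ℂ := monomial e 1
  let P : Polynomial ℂ := ∑ s ∈ f.support, Polynomial.monomial (t s) (coeff s f)
  have hPc : ∀ s ∈ f.support, P.coeff (t s) = coeff s f := by
    intro s hs
    simp only [P, Polynomial.finsetSum_coeff, Polynomial.coeff_monomial]
    rw [Finset.sum_eq_single s]
    · simp
    · intro s' hs' hne
      rw [if_neg]
      exact fun h => hne (htinj s' hs' s hs h)
    · exact fun h => absurd hs h
  have hP0 : P.coeff 0 ≠ 0 := by
    rw [← htw, hPc w hw]; exact mem_support_iff.mp hw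
  have hPT : P.coeff T ≠ 0 := by
    rw [← htz, hPc z hz]; exact mem_support_iff.mp hz
  have hdeg : P.degree ≠ 0 := by
    intro h
    have h1 := Polynomial.le_degree_of_ne_zero hPT
    rw [h] at h1
    have : T ≤ 0 := by exact_mod_cast h1
    omega
  obtain ⟨ζ, hζ⟩ := IsAlgClosed.exists_root P hdeg
  have hζ0 : ζ ≠ 0 := by
    rintro rfl
    apply hP0
    rw [Polynomial.coeff_zero_eq_eval_zero]
    exact hζ
  have hfs : f = ∑ s ∈ f.support, E * C (coeff s f) * (A ^ t s * B ^ (T - t s)) := by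
    conv_lhs => rw [f.as_sum]
    refine Finset.sum_congr rfl fun s hs => ?_
    simp only [E, A, B, monomial_pow, monomial_mul, one_pow, C_apply, mul_one, one_mul, add_zero]
    rw [← add_assoc, ← hdecomp s hs]
  have hz0 : ∑ s ∈ f.support, E * C (coeff s f) * ((C ζ * B) ^ t s * B ^ (T - t s)) = 0 := by
    have h1 : ∑ s ∈ f.support, coeff s f * ζ ^ t s = 0 := by
      have := hζ
      rw [Polynomial.IsRoot, Polynomial.eval_finsetSum] at this
      simpa [Polynomial.eval_monomial] using this
    have h2 : ∀ s ∈ f.support, E * C (coeff s f) * ((C ζ * B) ^ t s * B ^ (T - t s)) =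
        E * B ^ T * C (coeff s f * ζ ^ t s) := by
      intro s hs
      rw [mul_pow, mul_assoc (C ζ ^ t s), ← pow_add, Nat.add_sub_cancel' (htT s hs), C_mul, C_pow]
      ring
    rw [Finset.sum_congr rfl h2, ← Finset.mul_sum, ← map_sum, h1, C_0, mul_zero]
  have hdvd : A - C ζ * B ∣ f := by
    have h1 : f = ∑ s ∈ f.support, E * C (coeff s f) * B ^ (T - t s) *
        (A ^ t s - (C ζ * B) ^ t s) := by
      refine (hfs.trans (sub_zero _).symm).trans ?_
      rw [← hz0, ← Finset.sum_sub_distrib]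
      exact Finset.sum_congr rfl fun s hs => by ring
    rw [h1]
    exact Finset.dvd_sum fun s hs => Dvd.dvd.mul_left (sub_dvd_pow_sub_pow _ _ _) _
  have hai : 0 < a i := by
    simp only [a, Finsupp.equivFunOnFinite_symm_apply_apply]; omega
  have hbi : b i = 0 := by
    simp only [b, Finsupp.equivFunOnFinite_symm_apply_apply]; omega
  have hnu : ¬ IsUnit (A - C ζ * B) := by
    intro h
    obtain ⟨r, -, hr⟩ := isUnit_iff_eq_C_of_isReduced.mp h
    have h1 := congrArg (coeff a) hr
    have hab : b ≠ a := by
      intro h; rw [← h, hbi] at hai; omega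
    have ha0 : (0 : Fin n →₀ ℕ) ≠ a := by
      intro h; rw [← h] at hai; simp at hai
    simp only [A, B, coeff_sub, coeff_C_mul, coeff_monomial, coeff_C, if_neg hab, if_neg ha0] at h1
    simp at h1
  obtain ⟨q, hq⟩ := hdvd
  have hqu := (hirr.isUnit_or_isUnit hq).resolve_left hnu
  obtain ⟨c, hc, hqc⟩ := isUnit_iff_eq_C_of_isReduced.mp hqu
  refine ⟨c, a, b, ζ, hc.ne_zero, hζ0, ?_⟩
  rw [hq, hqc, mul_comm]
/-- extension of Ruppert's Proposition 1. Let `f ∈ ℂ[X_1, …, X_n]`,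
`n ≥ 2`, be an irreducible polynomial that is not a constant multiple of a monomial,
let `η_1, …, η_n` be `M`-th roots of unity, and suppose `f` divides
`f(η_1 X_1^N, …, η_n X_n^N)` for some `N > 1`. Then `f = c (X^u − ζ X^v)` for some
nonzero constant `c`, monomials `X^u, X^v`, and a root of unity `ζ` with
`ζ^{(N−1)M} = 1`. -/
theorem irreducible_factor_of_twist_is_binomial
    (n : ℕ) (hn : 2 ≤ n) (f : MvPolynomial (Fin n) ℂ)
    (hirr : Irreducible f)
    (hnontriv : ∀ (c : ℂ) (u : Fin n →₀ ℕ), f ≠ monomial u c)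
    (M : ℕ) (hM : 1 ≤ M) (η : Fin n → ℂ) (hη : ∀ i, η i ^ M = 1)
    (N : ℕ) (hN : 1 < N)
    (hdvd : f ∣ aeval (fun i => C (η i) * X i ^ N) f) :
    ∃ (c : ℂ) (u v : Fin n →₀ ℕ) (ζ : ℂ),
      c ≠ 0 ∧ ζ ^ ((N - 1) * M) = 1 ∧
      f = monomial u c - monomial v (c * ζ) := by
  have hd : f ∣ tw η N f := hdvd
  have hη0 : ∀ i, η i ≠ 0 := by
    intro i h
    have := hη i
    rw [h, zero_pow (by omega)] at this
    exact zero_ne_one this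
  obtain ⟨c, u, v, ζ, hc, hζ, hf⟩ := binomial_of_collinear f hirr hnontriv
    (fun u hu v hv w hw i j => collinear_support f hirr η hη0 N hN hd u v w hu hv hw i j)
  refine ⟨c, u, v, ζ, hc, ?_, ?_⟩
  swap
  · rw [hf, mul_sub, ← mul_assoc, ← C_mul, C_mul_monomial, C_mul_monomial, mul_one, mul_one]
  set A : MvPolynomial (Fin n) ℂ := monomial u 1 with hA
  set B : MvPolynomial (Fin n) ℂ := monomial v 1 with hB
  set α := ∏ i, η i ^ u i with hα
  set β := ∏ i, η i ^ v i with hβ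
  have hαM : α ^ M = 1 := by
    rw [hα, ← Finset.prod_pow]
    exact Finset.prod_eq_one fun i _ => by rw [← pow_mul, mul_comm, pow_mul, hη, one_pow]
  have hβM : β ^ M = 1 := by
    rw [hβ, ← Finset.prod_pow]
    exact Finset.prod_eq_one fun i _ => by rw [← pow_mul, mul_comm, pow_mul, hη, one_pow]
  have htC : ∀ x : ℂ, tw η N (C x) = C x := fun x => by simp [tw]
  have htA : tw η N A = C α * A ^ N := by
    rw [hA, tw_monomial, monomial_pow, C_mul_monomial]; simp [hα]
  have htB : tw η N B = C β * B ^ N := by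
    rw [hB, tw_monomial, monomial_pow, C_mul_monomial]; simp [hβ]
  have htf : tw η N f = C c * (C α * A ^ N - C ζ * (C β * B ^ N)) := by
    conv_lhs => rw [hf]
    rw [map_mul, map_sub, map_mul, htC, htC, htA, htB]
  have hcu : f ∣ C c * C α * (A ^ N - (C ζ * B) ^ N) := by
    obtain ⟨q, hq⟩ := sub_dvd_pow_sub_pow A (C ζ * B) N
    exact ⟨C α * q, by rw [hq]; conv_rhs => rw [hf]
                       ring⟩
  have hdiff : f ∣ monomial (N • v) (c * (α * ζ ^ N - ζ * β)) := by
    have h1 := dvd_sub hd hcu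
    rw [htf] at h1
    convert h1 using 1
    have : monomial (N • v) (c * (α * ζ ^ N - ζ * β)) = C (c * (α * ζ ^ N - ζ * β)) * B ^ N := by
      rw [hB, monomial_pow, C_mul_monomial]; simp
    rw [this]
    simp only [C_mul, C_sub, C_pow]
    ring
  have hzero : α * ζ ^ N - ζ * β = 0 := by
    by_contra hne
    obtain ⟨m, r, -, -, hfm⟩ := (dvd_monomial_iff_exists (mul_ne_zero hc hne)).mp hdiff
    exact hnontriv _ _ hfm
  have h1 : (α * ζ ^ N) ^ M = (ζ * β) ^ M := by rw [sub_eq_zero.mp hzero]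
  rw [mul_pow, mul_pow, hαM, hβM, one_mul, mul_one, ← pow_mul] at h1
  have h2 : N * M = (N - 1) * M + M := by
    obtain ⟨k, rfl⟩ : ∃ k, N = k + 1 := ⟨N - 1, by omega⟩
    simp; ring
  rw [h2, pow_add] at h1
  exact mul_right_cancel₀ (pow_ne_zero M hζ) (by rw [h1, one_mul])
end

section
/- Let z ≥ 2 be an integer and let f ∈ ℂ[X_1, …, X_n], n ≥ 2, be a (possibly reducible) nonzero polynomial of total degree d ≥ 2, and set t_0 = ⌈3 log(d)/log(z)⌉ and c_0 = t_0 + d(d−1). Then there exists an integer t_1 with t_0 ≤ t_1 ≤ c_0 such that each irreducible common factor g of the polynomials f and f^{t_1} = f(X_1^{z^{t_1}}, …, X_n^{z^{t_1}}) has the form g = c(X^u − ζ X^v), a constant or monomial multiple of a binomial X^a − ζ, where a is an integer vector and ζ is a root of unity satisfying ζ^{z^k(z^l − 1)} = 1 for some integers k, l with 0 ≤ k, l ≤ c_0. -/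
open MvPolynomial

namespace TorsionBinomial

variable {n : ℕ}

/-- extraction of the residue class `r` mod `p` of exponents -/
noncomputable def sect (p : ℕ) (r : Fin n →₀ ℕ) :
    MvPolynomial (Fin n) ℂ →ₗ[ℂ] MvPolynomial (Fin n) ℂ :=
  (basisMonomials (Fin n) ℂ).constr ℂ (fun m =>
    if m.mapRange (· % p) (Nat.zero_mod p) = r then
      monomial (m.mapRange (· / p) (Nat.zero_div p)) 1 else 0)

lemma sect_monomial (p : ℕ) (r m : Fin n →₀ ℕ) (c : ℂ) :
    sect p r (monomial m c) = if m.mapRange (· % p) (Nat.zero_mod p) = r then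
      monomial (m.mapRange (· / p) (Nat.zero_div p)) c else 0 := by
  have h1 : (monomial m c : MvPolynomial (Fin n) ℂ) = c • (basisMonomials (Fin n) ℂ) m := by
    rw [coe_basisMonomials, smul_monomial]; simp
  rw [h1, map_smul, sect, Module.Basis.constr_basis]
  split_ifs <;> simp [smul_monomial]

lemma sect_expand_mul (p : ℕ) (hp : 0 < p) (r : Fin n →₀ ℕ) (k b : MvPolynomial (Fin n) ℂ) :
    sect p r (expand p k * b) = k * sect p r b := by
  induction k using induction_on' with
  | add a c ha hc => rw [map_add, add_mul, map_add, ha, hc, add_mul]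
  | monomial w a =>
    induction b using induction_on' with
    | add x y hx hy => rw [mul_add, map_add, hx, hy, map_add, mul_add]
    | monomial m c =>
      rw [expand_monomial, monomial_mul, sect_monomial, sect_monomial]
      have h1 : (p • w + m).mapRange (· % p) (Nat.zero_mod p)
          = m.mapRange (· % p) (Nat.zero_mod p) := by
        ext i; simp
      have h2 : (p • w + m).mapRange (· / p) (Nat.zero_div p)
          = w + m.mapRange (· / p) (Nat.zero_div p) := by
        ext i; simp [Nat.mul_add_div hp]
      rw [h1, h2]
      split_ifs
      · rw [monomial_mul]
      · simp

lemma coeff_sect (p : ℕ) (hp : 0 < p) (r : Fin n →₀ ℕ)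
    (hr : r.mapRange (· % p) (Nat.zero_mod p) = r) (b : MvPolynomial (Fin n) ℂ)
    (u : Fin n →₀ ℕ) : coeff u (sect p r b) = coeff (p • u + r) b := by
  induction b using induction_on' with
  | add x y hx hy => rw [map_add, coeff_add, coeff_add, hx, hy]
  | monomial m c =>
    rw [sect_monomial, coeff_monomial]
    have hr' : ∀ i, r i % p = r i := fun i => by
      have := DFunLike.congr_fun hr i; simpa using this
    by_cases h : m = p • u + r
    · subst h
      rw [if_pos, coeff_monomial, if_pos, if_pos rfl]
      · ext i
        have h1 : r i / p = 0 := by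
          rw [Nat.div_eq_zero_iff]; right; rw [← hr' i]; exact Nat.mod_lt _ hp
        simp [Nat.mul_add_div hp, h1]
      · ext i; simp [hr']
    · rw [if_neg h]
      split_ifs with h1
      · rw [coeff_monomial, if_neg]
        intro h2
        apply h
        ext i
        have e1 := DFunLike.congr_fun h1 i
        have e2 := DFunLike.congr_fun h2 i
        simp at e1 e2
        simp only [Finsupp.add_apply, Finsupp.smul_apply, smul_eq_mul, ← e1, ← e2]
        exact (Nat.div_add_mod _ _).symm
      · simp

lemma totalDegree_pos {g : MvPolynomial (Fin n) ℂ} (hg : Irreducible g) : 0 < g.totalDegree := by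
  rw [Nat.pos_iff_ne_zero]
  intro h
  have h1 := totalDegree_eq_zero_iff_eq_C.1 h
  apply hg.not_isUnit
  rw [isUnit_iff_eq_C_of_isReduced]
  refine ⟨_, ?_, h1⟩
  rw [isUnit_iff_ne_zero]
  intro h2
  rw [h2, C_0] at h1
  exact hg.ne_zero h1

lemma coprime_expand {p : ℕ} (hp : 0 < p) {g h k : MvPolynomial (Fin n) ℂ}
    (hg : Irreducible g) (hh : Irreducible h) (h1 : g ∣ expand p h) (h2 : g ∣ expand p k) :
    h ∣ k := by
  by_contra hk
  obtain ⟨a, ha⟩ := h1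
  obtain ⟨b, hb⟩ := h2
  -- swap roles: h divides every section of a
  have hrel : expand p h * b = expand p k * a := by rw [ha, hb]; ring
  have ha0 : a ≠ 0 := by
    rintro rfl
    rw [mul_zero, expand_eq_zero hp] at ha
    exact hh.ne_zero ha
  obtain ⟨m, hm⟩ := MvPolynomial.ne_zero_iff.1 ha0
  set r := m.mapRange (· % p) (Nat.zero_mod p) with hr
  have hrr : r.mapRange (· % p) (Nat.zero_mod p) = r := by ext i; simp [hr]
  have hs0 : sect p r a ≠ 0 := by
    rw [MvPolynomial.ne_zero_iff]
    refine ⟨m.mapRange (· / p) (Nat.zero_div p), ?_⟩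
    rw [coeff_sect p hp r hrr]
    convert hm
    ext i
    simp [hr, Nat.div_add_mod]
  have hdv : h ∣ sect p r a := by
    have h3 : h ∣ k * sect p r a := by
      rw [← sect_expand_mul p hp, ← hrel, sect_expand_mul p hp]
      exact dvd_mul_right _ _
    exact (hh.prime.dvd_or_dvd h3).resolve_left hk
  have hd1 := totalDegree_le_of_dvd_of_isDomain hdv hs0
  have hd2 : (sect p r a).totalDegree * p ≤ a.totalDegree := by
    have : (sect p r a).totalDegree ≤ a.totalDegree / p := by
      refine Finset.sup_le fun u hu => ?_
      rw [mem_support_iff, coeff_sect p hp r hrr] at hu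
      rw [Nat.le_div_iff_mul_le hp]
      have := le_totalDegree (mem_support_iff.2 hu)
      refine le_trans ?_ this
      rw [Finsupp.sum_fintype _ _ (by simp), Finsupp.sum_fintype _ _ (by simp), Finset.sum_mul]
      refine Finset.sum_le_sum fun i _ => ?_
      simp [mul_comm]
    exact (Nat.le_div_iff_mul_le hp).1 this
  have hd3 : h.totalDegree * p = g.totalDegree + a.totalDegree := by
    rw [← totalDegree_expand, ha, totalDegree_mul_of_isDomain hg.ne_zero ha0]
  have hd4 := totalDegree_pos hg
  nlinarith

/-- diagonal rescaling of variables -/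
noncomputable def scale (ω : Fin n → ℂ) : MvPolynomial (Fin n) ℂ →ₐ[ℂ] MvPolynomial (Fin n) ℂ :=
  aeval (fun i => C (ω i) * X i)

lemma coeff_scale (ω : Fin n → ℂ) (g : MvPolynomial (Fin n) ℂ) (u : Fin n →₀ ℕ) :
    coeff u (scale ω g) = (∏ i, ω i ^ u i) * coeff u g := by
  induction g using induction_on' with
  | add x y hx hy => rw [map_add, coeff_add, coeff_add, hx, hy, mul_add]
  | monomial m c =>
    have h1 : scale ω (monomial m c) = monomial m ((∏ i, ω i ^ m i) * c) := by
      rw [scale, aeval_monomial, monomial_eq, Finsupp.prod_fintype _ _ (by simp),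
        Finsupp.prod_fintype _ _ (by simp)]
      simp only [mul_pow, Finset.prod_mul_distrib, algebraMap_eq, map_mul, map_prod, map_pow]
      ring
    rw [h1, coeff_monomial, coeff_monomial]
    split_ifs with h
    · rw [h]
    · simp

lemma scale_irreducible {ω : Fin n → ℂ} (hω : ∀ i, ω i ≠ 0) {g : MvPolynomial (Fin n) ℂ}
    (hg : Irreducible g) : Irreducible (scale ω g) := by
  let e : MvPolynomial (Fin n) ℂ ≃ₐ[ℂ] MvPolynomial (Fin n) ℂ :=
    AlgEquiv.ofAlgHom (scale ω) (scale (fun i => (ω i)⁻¹))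
      (by
        ext1 i
        simp only [scale, AlgHom.comp_apply, aeval_X, map_mul, algHom_C, algebraMap_eq,
          AlgHom.id_apply, ← mul_assoc]
        rw [← C_mul, inv_mul_cancel₀ (hω i), C_1, one_mul])
      (by
        ext1 i
        simp only [scale, AlgHom.comp_apply, aeval_X, map_mul, algHom_C, algebraMap_eq,
          AlgHom.id_apply, ← mul_assoc]
        rw [← C_mul, mul_inv_cancel₀ (hω i), C_1, one_mul])
  exact (MulEquiv.irreducible_iff e).2 hg

lemma scale_expand {ω : Fin n → ℂ} {N : ℕ} (hω : ∀ i, ω i ^ N = 1) (h : MvPolynomial (Fin n) ℂ) :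
    scale ω (expand N h) = expand N h := by
  have : (scale ω).comp (expand N) = expand N := by
    ext1 i
    rw [AlgHom.comp_apply, expand_X, map_pow, scale, aeval_X, mul_pow, ← C_pow, hω, C_1, one_mul]
  exact DFunLike.congr_fun this h

lemma totalDegree_prod_ge {ι : Type*} (s : Finset ι) (G : ι → MvPolynomial (Fin n) ℂ)
    (hG : ∀ i ∈ s, Irreducible (G i)) :
    s.card ≤ (∏ i ∈ s, G i).totalDegree := by
  classical
  induction s using Finset.induction_on with
  | empty => simp
  | insert a s ha ih =>
    rw [Finset.prod_insert ha, Finset.card_insert_of_notMem ha,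
      totalDegree_mul_of_isDomain (hG a (by simp)).ne_zero
        (Finset.prod_ne_zero_iff.2 fun i hi => (hG i (by simp [hi])).ne_zero)]
    have := ih fun i hi => hG i (by simp [hi])
    have := totalDegree_pos (hG a (by simp))
    omega

lemma card_le_totalDegree {ι : Type*} (s : Finset ι) (G : ι → MvPolynomial (Fin n) ℂ)
    {F : MvPolynomial (Fin n) ℂ} (hF : F ≠ 0)
    (hG : ∀ i ∈ s, Irreducible (G i)) (hd : ∀ i ∈ s, G i ∣ F)
    (hna : ∀ i ∈ s, ∀ j ∈ s, Associated (G i) (G j) → i = j) :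
    s.card ≤ F.totalDegree := by
  refine (totalDegree_prod_ge s G hG).trans (totalDegree_le_of_dvd_of_isDomain ?_ hF)
  refine Finset.prod_dvd_of_isRelPrime ?_ hd
  intro i hi j hj hij
  refine (hG i hi).isRelPrime_iff_not_dvd.2 fun h => hij (hna i hi j hj ?_)
  exact (hG i hi).associated_of_dvd (hG j hj) h

lemma collinear {g h : MvPolynomial (Fin n) ℂ} (hg : Irreducible g) (hh : h ≠ 0)
    (hN : ∀ B : ℕ, ∃ N, B ≤ N ∧ g ∣ expand N h) {u₀ u₁ u₂ : Fin n →₀ ℕ}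
    (h0 : coeff u₀ g ≠ 0) (h1 : coeff u₁ g ≠ 0) (h2 : coeff u₂ g ≠ 0) (i j : Fin n) :
    ((u₁ i : ℤ) - u₀ i) * ((u₂ j : ℤ) - u₀ j) - ((u₁ j : ℤ) - u₀ j) * ((u₂ i : ℤ) - u₀ i) = 0 := by
  by_contra hD
  set D : ℤ := ((u₁ i : ℤ) - u₀ i) * ((u₂ j : ℤ) - u₀ j)
    - ((u₁ j : ℤ) - u₀ j) * ((u₂ i : ℤ) - u₀ i) with hDdef
  have hij : i ≠ j := by
    rintro rfl
    apply hD
    rw [hDdef]; ring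
  set A := D.natAbs with hA
  have hApos : 0 < A := Int.natAbs_pos.2 hD
  set H := h.totalDegree
  obtain ⟨N, hNB, hdvd⟩ := hN (A * (2 * A * H + 1) + A + 1)
  have hNpos : 0 < N := by omega
  set K := N / A with hK
  have hKA : K * A ≤ N := Nat.div_mul_le_self N A
  have hKpos : 0 < K := Nat.div_pos (by omega) hApos
  have hNlt : N < A * (K + 1) := Nat.lt_mul_div_succ N hApos
  obtain ⟨e, he⟩ : ∃ e : ℂ, IsPrimitiveRoot e N :=
    ⟨_, Complex.isPrimitiveRoot_exp N hNpos.ne'⟩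
  have he0 : e ≠ 0 := he.ne_zero hNpos.ne'
  let w : ℕ × ℕ → Fin n → ℂ := fun ab l => if l = i then e ^ ab.1 else if l = j then e ^ ab.2 else 1
  have hw : ∀ ab (u : Fin n →₀ ℕ), ∏ l, w ab l ^ u l = e ^ (ab.1 * u i + ab.2 * u j) := by
    intro ab u
    rw [Fintype.prod_eq_mul i j hij]
    · simp only [w, if_true, if_neg hij.symm, ← pow_mul, ← pow_add]
    · rintro l ⟨hl1, hl2⟩
      simp [w, hl1, hl2]
  have hw0 : ∀ ab l, w ab l ≠ 0 := by
    intro ab l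
    simp only [w]
    split_ifs
    · exact pow_ne_zero _ he0
    · exact pow_ne_zero _ he0
    · exact one_ne_zero
  have hwN : ∀ ab l, w ab l ^ N = 1 := by
    intro ab l
    simp only [w]
    split_ifs
    · rw [← pow_mul, mul_comm, pow_mul, he.pow_eq_one, one_pow]
    · rw [← pow_mul, mul_comm, pow_mul, he.pow_eq_one, one_pow]
    · exact one_pow _
  have hF : expand N h ≠ 0 := (expand_ne_zero hNpos).2 hh
  have key := card_le_totalDegree (Finset.range K ×ˢ Finset.range K) (fun ab => scale (w ab) g) hF
    (fun ab _ => scale_irreducible (hw0 ab) hg)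
    (fun ab _ => by
      rw [← scale_expand (hwN ab) h]
      exact map_dvd _ hdvd)
    (by
      rintro ⟨a, b⟩ hab ⟨a', b'⟩ hab' hass
      simp only [Finset.mem_product, Finset.mem_range] at hab hab'
      obtain ⟨c, hc⟩ := hass
      obtain ⟨γ, hγ, hcγ⟩ := isUnit_iff_eq_C_of_isReduced.1 c.isUnit
      have hγ0 : γ ≠ 0 := hγ.ne_zero
      have hco : ∀ u, coeff u g ≠ 0 → e ^ (a * u i + b * u j) * γ = e ^ (a' * u i + b' * u j) := by
        intro u hu
        have h3 := congrArg (coeff u) hc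
        rw [hcγ, mul_comm, coeff_C_mul, coeff_scale, coeff_scale, hw, hw, ← mul_assoc] at h3
        have h4 := mul_right_cancel₀ hu h3
        rw [mul_comm]; exact h4
      have hdv : ∀ u, coeff u g ≠ 0 → (N : ℤ) ∣ ((a : ℤ) - a') * ((u i : ℤ) - u₀ i)
          + ((b : ℤ) - b') * ((u j : ℤ) - u₀ j) := by
        intro u hu
        have e1 := hco u hu
        have e2 := hco u₀ h0
        have e3 : e ^ (a * u i + b * u j + (a' * u₀ i + b' * u₀ j))
            = e ^ (a' * u i + b' * u j + (a * u₀ i + b * u₀ j)) := by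
          rw [pow_add e (a * u i + b * u j), pow_add e (a' * u i + b' * u j), ← e1, ← e2]; ring
        rw [← he.zpow_eq_one_iff_dvd]
        have e4 : ((a : ℤ) - a') * ((u i : ℤ) - u₀ i)
          + ((b : ℤ) - b') * ((u j : ℤ) - u₀ j) =
            ((a * u i + b * u j + (a' * u₀ i + b' * u₀ j) : ℕ) : ℤ)
            - ((a' * u i + b' * u j + (a * u₀ i + b * u₀ j) : ℕ) : ℤ) := by
          push_cast; ring
        rw [e4, zpow_sub₀ he0, zpow_natCast, zpow_natCast, e3, div_self (pow_ne_zero _ he0)]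
      have d1 := hdv u₁ h1
      have d2 := hdv u₂ h2
      have small : ∀ x : ℤ, (N : ℤ) ∣ D * x → |x| < K → x = 0 := by
        intro x hx hxK
        have h5 : D * x = 0 := by
          apply Int.eq_zero_of_abs_lt_dvd hx
          rw [abs_mul, Int.abs_eq_natAbs D, ← hA]
          have : (K : ℤ) * A ≤ N := by exact_mod_cast hKA
          have h6 : (0 : ℤ) < A := by exact_mod_cast hApos
          nlinarith
        exact (mul_eq_zero.1 h5).resolve_left hD
      have r1 : (a : ℤ) - a' = 0 := by
        apply small
        · have := dvd_sub (d1.mul_right ((u₂ j : ℤ) - u₀ j)) (d2.mul_right ((u₁ j : ℤ) - u₀ j))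
          refine this.trans (dvd_of_eq ?_)
          rw [hDdef]; ring
        · rw [abs_lt]; omega
      have r2 : (b : ℤ) - b' = 0 := by
        apply small
        · have := dvd_sub (d2.mul_right ((u₁ i : ℤ) - u₀ i)) (d1.mul_right ((u₂ i : ℤ) - u₀ i))
          refine this.trans (dvd_of_eq ?_)
          rw [hDdef]; ring
        · rw [abs_lt]; omega
      ext <;> simp <;> omega)
  rw [Finset.card_product, Finset.card_range, totalDegree_expand] at key
  change K * K ≤ H * N at key
  have k1 : K * K ≤ H * (A * (K + 1)) := key.trans (Nat.mul_le_mul_left _ hNlt.le)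
  have k2 : K * K ≤ (2 * A * H) * K := by
    have : H * (A * (K + 1)) ≤ H * (A * (2 * K)) := by gcongr; omega
    calc _ ≤ _ := k1.trans this
      _ = _ := by ring
  have k3 : K ≤ 2 * A * H := Nat.le_of_mul_le_mul_right k2 hKpos
  have k4 : A * (K + 1) ≤ A * (2 * A * H + 1) := by gcongr
  omega

/-- an irreducible polynomial with collinear support is a monomial or a binomial -/
lemma binomial_of_collinear {g : MvPolynomial (Fin n) ℂ} (hg : Irreducible g)
    (hc : ∀ u₀ u₁ u₂ : Fin n →₀ ℕ, coeff u₀ g ≠ 0 → coeff u₁ g ≠ 0 → coeff u₂ g ≠ 0 → ∀ i j,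
      ((u₁ i : ℤ) - u₀ i) * ((u₂ j : ℤ) - u₀ j)
        - ((u₁ j : ℤ) - u₀ j) * ((u₂ i : ℤ) - u₀ i) = 0) :
    (∃ u c, c ≠ 0 ∧ g = monomial u c) ∨
    ∃ u v c ρ, c ≠ 0 ∧ ρ ≠ 0 ∧ u ≠ v ∧ g = monomial u c - monomial v (c * ρ) := by
  classical
  by_cases hall : ∀ u u' : Fin n →₀ ℕ, coeff u g ≠ 0 → coeff u' g ≠ 0 → u = u'
  · left
    obtain ⟨u, hu⟩ := MvPolynomial.ne_zero_iff.1 hg.ne_zero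
    refine ⟨u, _, hu, ?_⟩
    ext m
    rw [coeff_monomial]
    split_ifs with h
    · rw [h]
    · by_contra hm
      exact h (hall u m hu hm)
  push Not at hall
  obtain ⟨p, p', hp, hp', hpp⟩ := hall
  obtain ⟨i, hi⟩ : ∃ i, p i ≠ p' i := by
    by_contra hcon
    push Not at hcon
    exact hpp (Finsupp.ext hcon)
  have hne : g.support.Nonempty := ⟨p, mem_support_iff.2 hp⟩
  obtain ⟨u₀, hu₀, hmin⟩ := g.support.exists_min_image (fun u => u i) hne
  obtain ⟨um, hum, hmax⟩ := g.support.exists_max_image (fun u => u i) hne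
  have hlt : u₀ i < um i := by
    have a1 := hmin p (mem_support_iff.2 hp)
    have a2 := hmin p' (mem_support_iff.2 hp')
    have a3 := hmax p (mem_support_iff.2 hp)
    have a4 := hmax p' (mem_support_iff.2 hp')
    omega
  rw [mem_support_iff] at hu₀ hum
  let v : Fin n → ℤ := fun l => (um l : ℤ) - u₀ l
  have hvi : 0 < v i := by simp only [v]; omega
  -- primitive direction
  obtain ⟨e, b, s, he, hvb, hs⟩ : ∃ (e : ℕ) (b s : Fin n → ℤ), 0 < e ∧ (∀ l, v l = e * b l) ∧
      ∑ l, s l * b l = 1 := by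
    obtain ⟨e', he'⟩ := (IsPrincipalIdealRing.principal (Ideal.span (Set.range v))).principal
    have h1 : ∀ l, e' ∣ v l := fun l => by
      have : v l ∈ Ideal.span (Set.range v) := Ideal.subset_span ⟨l, rfl⟩
      rw [he'] at this
      exact Ideal.mem_span_singleton.1 this
    have h2 : e' ∈ Ideal.span (Set.range v) := by
      rw [he']; exact Ideal.mem_span_singleton_self e'
    have he0 : e' ≠ 0 := by
      rintro rfl
      have := h1 i
      rw [zero_dvd_iff] at this
      omega
    obtain ⟨s, hs⟩ := Ideal.mem_span_range_iff_exists_fun.1 h2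
    choose b hb using h1
    have hs' : ∑ l, s l * b l = 1 := by
      apply mul_left_cancel₀ he0
      rw [Finset.mul_sum, mul_one]
      conv_rhs => rw [← hs]
      refine Finset.sum_congr rfl fun l _ => ?_
      rw [hb l]; ring
    refine ⟨e'.natAbs, fun l => e'.sign * b l, fun l => e'.sign * s l, Int.natAbs_pos.2 he0,
      fun l => ?_, ?_⟩
    · rw [← mul_assoc, mul_comm (e'.natAbs : ℤ), Int.sign_mul_natAbs, hb l]
    · rw [← hs']
      refine Finset.sum_congr rfl fun l _ => ?_
      have : e'.sign * e'.sign = 1 := by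
        rcases lt_or_gt_of_ne he0 with h | h
        · rw [Int.sign_eq_neg_one_of_neg h]; rfl
        · rw [Int.sign_eq_one_of_pos h]; rfl
      linear_combination (s l * b l) * this
  have heZ : (0 : ℤ) < e := by exact_mod_cast he
  have hbi : 0 < b i := by
    have := hvb i
    by_contra hcon
    push Not at hcon
    nlinarith
  let B : Fin n →₀ ℕ := Finsupp.equivFunOnFinite.symm fun l => (b l).toNat
  let B' : Fin n →₀ ℕ := Finsupp.equivFunOnFinite.symm fun l => (-b l).toNat
  let w : Fin n →₀ ℕ := Finsupp.equivFunOnFinite.symm fun l => ((u₀ l : ℤ) - e * (-b l).toNat).toNat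
  have hB : ∀ l, B l = (b l).toNat := fun l => rfl
  have hB' : ∀ l, B' l = (-b l).toNat := fun l => rfl
  have hw : ∀ l, (w l : ℤ) = (u₀ l : ℤ) - e * (-b l).toNat := by
    intro l
    change ((((u₀ l : ℤ) - e * (-b l).toNat).toNat : ℕ) : ℤ) = _
    apply Int.toNat_of_nonneg
    have h1 := hvb l
    simp only [v] at h1
    rcases le_total 0 (b l) with h | h
    · rw [Int.toNat_of_nonpos (by omega)]; simp
    · rw [Int.toNat_of_nonneg (by omega)]; nlinarith
  -- the parametrisation
  have hpar : ∀ u, coeff u g ≠ 0 → ∃ k ≤ e, u = w + k • B + (e - k) • B' := by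
    intro u hu
    have hrel : ∀ l l', b l * ((u l' : ℤ) - u₀ l') = b l' * ((u l : ℤ) - u₀ l) := by
      intro l l'
      have h1 := hc u₀ um u hu₀ hum hu l l'
      have h2 := hvb l
      have h3 := hvb l'
      simp only [v] at h2 h3
      rw [h2, h3] at h1
      apply mul_left_cancel₀ heZ.ne'
      linear_combination h1
    set k : ℤ := ∑ l, s l * ((u l : ℤ) - u₀ l) with hk
    have hkb : ∀ l, (u l : ℤ) - u₀ l = k * b l := by
      intro l
      calc (u l : ℤ) - u₀ l = (∑ l', s l' * b l') * ((u l : ℤ) - u₀ l) := by rw [hs, one_mul]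
        _ = k * b l := by
          rw [hk, Finset.sum_mul, Finset.sum_mul]
          refine Finset.sum_congr rfl fun l' _ => ?_
          linear_combination (s l') * (hrel l' l)
    have hk0 : 0 ≤ k := by
      have h1 := hmin u (mem_support_iff.2 hu)
      have h2 := hkb i
      by_contra hcon
      push Not at hcon
      nlinarith
    have hke : k ≤ e := by
      have h1 := hmax u (mem_support_iff.2 hu)
      have h2 := hkb i
      have h3 := hvb i
      simp only [v] at h3
      by_contra hcon
      push Not at hcon
      nlinarith
    lift k to ℕ using hk0 with k0
    have hke' : k0 ≤ e := by exact_mod_cast hke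
    refine ⟨k0, hke', ?_⟩
    ext l
    have h2 := hkb l
    have h3 := hw l
    simp only [Finsupp.add_apply, Finsupp.smul_apply, smul_eq_mul, hB, hB']
    zify
    push_cast [hke']
    rw [h3]
    rcases le_total 0 (b l) with h | h
    · rw [Int.toNat_of_nonneg h, Int.toNat_of_nonpos (by omega : -b l ≤ 0)]
      push_cast
      linarith
    · rw [Int.toNat_of_nonneg (by omega : 0 ≤ -b l), Int.toNat_of_nonpos h]
      push_cast
      linear_combination h2
  have hBi : B i ≠ B' i := by rw [hB, hB']; omega
  have hBB : B ≠ B' := fun h => hBi (by rw [h])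
  have hB'i : B' i = 0 := by rw [hB']; omega
  let T : ℕ → Fin n →₀ ℕ := fun k => w + k • B + (e - k) • B'
  have hinj : ∀ k k', T k = T k' → k = k' := by
    intro k k' h
    have h1 := DFunLike.congr_fun h i
    simp only [T, Finsupp.add_apply, Finsupp.smul_apply, smul_eq_mul, hB'i, mul_zero, add_zero,
      add_right_inj] at h1
    exact Nat.eq_of_mul_eq_mul_right (by omega) h1
  have hgsum : g = ∑ k ∈ Finset.range (e + 1), monomial (T k) (coeff (T k) g) := by
    ext m
    rw [coeff_sum]
    simp only [coeff_monomial]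
    by_cases hm : coeff m g = 0
    · rw [hm, Finset.sum_eq_zero]
      intro k _
      split_ifs with h
      · rw [h, hm]
      · rfl
    · obtain ⟨k, hk, rfl⟩ := hpar m hm
      rw [Finset.sum_eq_single k]
      · rw [if_pos rfl]
      · intro k' _ hk'
        rw [if_neg]
        exact fun h => hk' (hinj k' k h)
      · intro h
        exact absurd (Finset.mem_range.2 (by omega)) h
  have hume : T e = um := by
    ext l
    have h1 := hvb l
    have h2 := hw l
    simp only [v] at h1
    simp only [T, Finsupp.add_apply, Finsupp.smul_apply, smul_eq_mul, Nat.sub_self, zero_mul,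
      add_zero, hB]
    zify
    rw [h2]
    rcases le_total 0 (b l) with h | h
    · rw [Int.toNat_of_nonneg h, Int.toNat_of_nonpos (by omega : -b l ≤ 0)]
      push_cast
      linarith
    · rw [Int.toNat_of_nonneg (by omega : 0 ≤ -b l), Int.toNat_of_nonpos h]
      push_cast
      linear_combination -h1
  let P : Polynomial ℂ := ∑ k ∈ Finset.range (e + 1), Polynomial.monomial k (coeff (T k) g)
  have hPe : P.coeff e = coeff um g := by
    simp only [P, Polynomial.finsetSum_coeff, Polynomial.coeff_monomial]
    rw [Finset.sum_eq_single e]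
    · rw [if_pos rfl, hume]
    · intro k _ hk
      rw [if_neg hk]
    · intro h; exact absurd (Finset.mem_range.2 (by omega)) h
  have hPdeg : P.degree ≠ 0 := by
    intro h
    have h1 := Polynomial.le_degree_of_ne_zero (hPe ▸ hum : P.coeff e ≠ 0)
    rw [h] at h1
    have : e ≤ 0 := by exact_mod_cast h1
    omega
  obtain ⟨ρ, hρ⟩ := IsAlgClosed.exists_root P hPdeg
  have hρ' : ∑ k ∈ Finset.range (e + 1), coeff (T k) g * ρ ^ k = 0 := by
    have : P.eval ρ = 0 := hρ
    simpa only [P, Polynomial.eval_finsetSum, Polynomial.eval_monomial] using this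
  have hdvd : (monomial B 1 - monomial B' ρ : MvPolynomial (Fin n) ℂ) ∣ g := by
    have hterm : ∀ k, (monomial (T k) (coeff (T k) g) : MvPolynomial (Fin n) ℂ) =
        monomial w 1 * C (coeff (T k) g) * monomial B' 1 ^ (e - k) * monomial B 1 ^ k := by
      intro k
      simp only [T, monomial_pow, one_pow, monomial_mul, mul_one, one_mul, C_apply,
        add_zero]
      congr 2
      abel
    have h0 : monomial w 1 * monomial B' 1 ^ e *
        C (∑ k ∈ Finset.range (e + 1), coeff (T k) g * ρ ^ k) = (0 : MvPolynomial (Fin n) ℂ) := by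
      rw [hρ', C_0, mul_zero]
    have h1 : g = ∑ k ∈ Finset.range (e + 1),
        (monomial w 1 * C (coeff (T k) g) * monomial B' 1 ^ (e - k)) *
          (monomial B 1 ^ k - monomial B' ρ ^ k) := by
      conv_lhs => rw [hgsum, ← sub_zero (∑ k ∈ Finset.range (e + 1), _), ← h0]
      rw [map_sum, Finset.mul_sum, ← Finset.sum_sub_distrib]
      refine Finset.sum_congr rfl fun k hk => ?_
      have hk' : k ≤ e := by have := Finset.mem_range.1 hk; omega
      have h2 : (monomial B' ρ : MvPolynomial (Fin n) ℂ) = C ρ * monomial B' 1 := by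
        rw [C_mul_monomial, mul_one]
      rw [hterm k, h2, mul_pow]
      conv_lhs => rw [← Nat.sub_add_cancel hk', pow_add]
      simp only [map_mul, map_pow, Nat.sub_add_cancel hk']
      ring
    rw [h1]
    exact Finset.dvd_sum fun k _ => Dvd.dvd.mul_left (sub_dvd_pow_sub_pow _ _ k) _
  have hnu : ¬ IsUnit (monomial B 1 - monomial B' ρ : MvPolynomial (Fin n) ℂ) := by
    intro h
    obtain ⟨r, _, hr⟩ := isUnit_iff_eq_C_of_isReduced.1 h
    have h1 := congrArg (coeff B) hr
    have hB0 : (0 : Fin n →₀ ℕ) ≠ B := by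
      intro h
      have : B i = 0 := by rw [← h]; rfl
      omega
    rw [coeff_sub, coeff_monomial, coeff_monomial, coeff_C, if_pos rfl, if_neg hBB.symm,
      if_neg hB0] at h1
    simp at h1
  obtain ⟨q, hq⟩ := hdvd
  have hqu := (hg.isUnit_or_isUnit hq).resolve_left hnu
  obtain ⟨c, hcu, rfl⟩ := isUnit_iff_eq_C_of_isReduced.1 hqu
  have hc0 : c ≠ 0 := hcu.ne_zero
  have hfin : g = monomial B c - monomial B' (c * ρ) := by
    rw [hq, mul_comm, mul_sub, C_mul_monomial, C_mul_monomial, mul_one]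
  by_cases hρ0 : ρ = 0
  · left
    refine ⟨B, c, hc0, ?_⟩
    rw [hfin, hρ0]; simp
  · right
    exact ⟨B, B', c, ρ, hc0, hρ0, hBB, hfin⟩

lemma exists_torus_point {u v : Fin n →₀ ℕ} {η : ℂ} (hη : η ≠ 0) {i : Fin n} (hi : u i ≠ v i)
    (s : Fin n → ℂ) (hs : ∀ l, s l ≠ 0) :
    ∃ θ : ℂ, θ ≠ 0 ∧ ∏ l, Function.update s i θ l ^ u l = η * ∏ l, Function.update s i θ l ^ v l := by
  have hprod : ∀ (θ : ℂ) (m : Fin n →₀ ℕ), ∏ l, Function.update s i θ l ^ m l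
      = θ ^ m i * ∏ l ∈ Finset.univ.erase i, s l ^ m l := by
    intro θ m
    rw [← Finset.mul_prod_erase _ _ (Finset.mem_univ i), Function.update_self]
    congr 1
    refine Finset.prod_congr rfl fun l hl => ?_
    rw [Function.update_of_ne (Finset.ne_of_mem_erase hl)]
  simp only [hprod]
  set S := ∏ l ∈ Finset.univ.erase i, s l ^ u l with hS
  set S' := ∏ l ∈ Finset.univ.erase i, s l ^ v l with hS'
  have hS0 : S ≠ 0 := Finset.prod_ne_zero_iff.2 fun l _ => pow_ne_zero _ (hs l)
  have hS0' : S' ≠ 0 := Finset.prod_ne_zero_iff.2 fun l _ => pow_ne_zero _ (hs l)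
  rcases lt_or_gt_of_ne hi with h | h
  · obtain ⟨θ, hθ⟩ := IsAlgClosed.exists_pow_nat_eq (S / (η * S')) (Nat.sub_pos_of_lt h)
    have hθ0 : θ ≠ 0 := by
      rintro rfl
      rw [zero_pow (by omega)] at hθ
      exact div_ne_zero hS0 (mul_ne_zero hη hS0') hθ.symm
    refine ⟨θ, hθ0, ?_⟩
    rw [← Nat.sub_add_cancel h.le, pow_add, hθ]
    field_simp
  · obtain ⟨θ, hθ⟩ := IsAlgClosed.exists_pow_nat_eq (η * S' / S) (Nat.sub_pos_of_lt h)
    have hθ0 : θ ≠ 0 := by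
      rintro rfl
      rw [zero_pow (by omega)] at hθ
      exact div_ne_zero (mul_ne_zero hη hS0') hS0 hθ.symm
    refine ⟨θ, hθ0, ?_⟩
    rw [← Nat.sub_add_cancel h.le, pow_add, hθ]
    field_simp

lemma eval_mono (x : Fin n → ℂ) (u : Fin n →₀ ℕ) (c : ℂ) :
    eval x (monomial u c) = c * ∏ l, x l ^ u l := by
  rw [eval_monomial, Finsupp.prod_fintype _ _ (by simp)]

lemma exists_ne {u v : Fin n →₀ ℕ} (h : u ≠ v) : ∃ i, u i ≠ v i := by
  by_contra hcon
  push Not at hcon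
  exact h (Finsupp.ext hcon)

lemma torsion_of_pow {θ ζ : ℂ} (hθ : θ ≠ 0) {a b m : ℕ} (hab : a ≠ b) (hm : 0 < m)
    (hζ : ζ ^ m = 1) (h : θ ^ a = ζ * θ ^ b) : ∃ k : ℕ, 0 < k ∧ θ ^ k = 1 := by
  have h1 : θ ^ (a * m) = θ ^ (b * m) := by
    rw [pow_mul, h, mul_pow, hζ, one_mul, pow_mul]
  have main : ∀ x y : ℕ, x < y → θ ^ x = θ ^ y → ∃ k : ℕ, 0 < k ∧ θ ^ k = 1 := by
    intro x y hxy hh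
    refine ⟨y - x, by omega, ?_⟩
    rw [← Nat.sub_add_cancel hxy.le, pow_add] at hh
    apply mul_right_cancel₀ (pow_ne_zero x hθ)
    rw [← hh, one_mul]
  have hne : a * m ≠ b * m := fun h => hab (Nat.eq_of_mul_eq_mul_right hm h)
  rcases lt_or_gt_of_ne hne with h2 | h2
  · exact main _ _ h2 h1
  · exact main _ _ h2 h1.symm

/-- the shape claimed -/
lemma core {p q : ℕ} (hp : 0 < p) (hq : 2 ≤ q) {g h : MvPolynomial (Fin n) ℂ}
    (hg : Irreducible g) (hh : Irreducible h) (hhq : h ∣ expand q h) (hgp : g ∣ expand p h) :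
    ∃ (c : ℂ) (u v : Fin n →₀ ℕ) (ζ : ℂ), c ≠ 0 ∧ (∃ m : ℕ, 0 < m ∧ ζ ^ m = 1) ∧
      g = monomial u c - monomial v (c * ζ) := by
  have hit : ∀ m : ℕ, h ∣ expand (q ^ m) h := by
    intro m
    induction m with
    | zero => simp
    | succ m ih =>
      rw [pow_succ, expand_mul]
      exact ih.trans (map_dvd _ hhq)
  have hgit : ∀ m : ℕ, g ∣ expand (p * q ^ m) h := by
    intro m
    rw [expand_mul]
    exact hgp.trans (map_dvd _ (hit m))
  have hbig : ∀ B : ℕ, B ≤ q ^ B := fun B => (Nat.lt_pow_self (by omega)).le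
  have hgb := binomial_of_collinear hg fun u₀ u₁ u₂ h0 h1 h2 i j =>
    collinear hg hh.ne_zero (fun B => ⟨p * q ^ B, by have := hbig B; nlinarith, hgit B⟩) h0 h1 h2 i j
  have hhb := binomial_of_collinear hh fun u₀ u₁ u₂ h0 h1 h2 i j =>
    collinear hh hh.ne_zero (fun B => ⟨q ^ B, hbig B, hit B⟩) h0 h1 h2 i j
  rcases hgb with ⟨u, c, hc, rfl⟩ | ⟨u, v, c, η, hc, hη, huv, hgeq⟩
  · refine ⟨c / 2, u, u, -1, by simpa using hc, ⟨2, by norm_num, by norm_num⟩, ?_⟩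
    rw [← map_sub]
    congr 1
    ring
  refine ⟨c, u, v, η, hc, ?_, hgeq⟩
  -- vanishing
  have hvan : ∀ x : Fin n → ℂ, ∏ l, x l ^ u l = η * ∏ l, x l ^ v l → eval x (expand p h) = 0 := by
    intro x hx
    obtain ⟨k, hk⟩ := hgp
    rw [hk, map_mul, hgeq, map_sub, eval_mono, eval_mono, hx]
    ring
  obtain ⟨i, hi⟩ := exists_ne huv
  have hupd : ∀ (s : Fin n → ℂ) (i : Fin n) (θ : ℂ), (∀ l, s l ≠ 0) → θ ≠ 0 →
      ∀ l, Function.update s i θ l ≠ 0 := by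
    intro s i θ hs hθ l
    by_cases hl : l = i
    · subst hl; rwa [Function.update_self]
    · rw [Function.update_of_ne hl]; exact hs l
  rcases hhb with ⟨u', c', hc', rfl⟩ | ⟨u', v', c', ζ, hc', hζ, huv', hheq⟩
  · exfalso
    obtain ⟨θ, hθ, hx⟩ := exists_torus_point hη hi (fun _ => 1) (fun _ => one_ne_zero)
    have h1 := hvan _ hx
    rw [expand_monomial, eval_mono] at h1
    refine mul_ne_zero hc' (Finset.prod_ne_zero_iff.2 fun l _ => pow_ne_zero _ ?_) h1
    exact hupd _ _ _ (fun _ => one_ne_zero) hθ l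
  have hexp : ∀ (r : ℕ) (x : Fin n → ℂ), eval x (expand r h) = 0 →
      ∏ l, x l ^ (r * u' l) = ζ * ∏ l, x l ^ (r * v' l) := by
    intro r x hx
    rw [hheq, map_sub, expand_monomial, expand_monomial, map_sub, eval_mono, eval_mono] at hx
    simp only [Finsupp.smul_apply, smul_eq_mul] at hx
    apply mul_left_cancel₀ hc'
    linear_combination hx
  obtain ⟨j, hj⟩ := exists_ne huv'
  have hζt : ζ ^ (q - 1) = 1 := by
    obtain ⟨θ, hθ, hx⟩ := exists_torus_point hζ hj (fun _ => 1) (fun _ => one_ne_zero)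
    set x := Function.update (fun _ : Fin n => (1 : ℂ)) j θ with hxdef
    have h1 : eval x (expand q h) = 0 := by
      obtain ⟨k, hk⟩ := hhq
      rw [hk, map_mul, hheq, map_sub, eval_mono, eval_mono, hx]
      ring
    have h2 := hexp q x h1
    simp only [mul_comm q, pow_mul, Finset.prod_pow] at h2
    rw [hx, mul_pow] at h2
    have h3 : (∏ l, x l ^ v' l) ^ q ≠ 0 := pow_ne_zero _ (Finset.prod_ne_zero_iff.2 fun l _ =>
      pow_ne_zero _ (hupd _ _ _ (fun _ => one_ne_zero) hθ l))
    have h4 := mul_right_cancel₀ h3 h2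
    apply mul_right_cancel₀ hζ
    rw [← pow_succ, one_mul, Nat.sub_add_cancel (by omega), h4]
  have hprod1 : ∀ (i : Fin n) (θ : ℂ) (m : Fin n → ℕ),
      ∏ l, Function.update (fun _ : Fin n => (1 : ℂ)) i θ l ^ m l = θ ^ m i := by
    intro i θ m
    rw [Fintype.prod_eq_single i, Function.update_self]
    intro l hl
    rw [Function.update_of_ne hl, one_pow]
  by_cases hi' : u' i = v' i
  · exfalso
    have hji : j ≠ i := by rintro rfl; exact hj hi'
    obtain ⟨θ, hθ, hx⟩ := exists_torus_point hη hi (Function.update (fun _ => 1) j 2)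
      (hupd _ _ _ (fun _ => one_ne_zero) two_ne_zero)
    have h1 := hexp p _ (hvan _ hx)
    have hprod2 : ∀ m : Fin n → ℕ,
        ∏ l, Function.update (Function.update (fun _ : Fin n => (1 : ℂ)) j 2) i θ l ^ m l
          = 2 ^ m j * θ ^ m i := by
      intro m
      rw [Fintype.prod_eq_mul j i hji, Function.update_self, Function.update_of_ne hji,
        Function.update_self]
      rintro l ⟨hl1, hl2⟩
      rw [Function.update_of_ne hl2, Function.update_of_ne hl1, one_pow]
    rw [hprod2, hprod2, hi', ← mul_assoc] at h1
    have h2 := mul_right_cancel₀ (pow_ne_zero _ hθ) h1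
    have hn : ‖ζ‖ = 1 := IsOfFinOrder.norm_eq_one (isOfFinOrder_iff_pow_eq_one.2 ⟨q - 1, by omega, hζt⟩)
    have h3 := congrArg norm h2
    rw [norm_mul, hn, one_mul, norm_pow, norm_pow, Complex.norm_ofNat] at h3
    have h4 := pow_right_injective₀ (by norm_num : (0 : ℝ) < 2) (by norm_num) h3
    exact hj (Nat.eq_of_mul_eq_mul_left hp h4)
  · obtain ⟨θ, hθ, hx⟩ := exists_torus_point hη hi (fun _ => 1) (fun _ => one_ne_zero)
    have h1 := hexp p _ (hvan _ hx)
    rw [hprod1, hprod1] at h1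
    rw [hprod1, hprod1] at hx
    obtain ⟨k, hk, hθk⟩ := torsion_of_pow hθ
      (fun h => hi' (Nat.eq_of_mul_eq_mul_left hp h)) (by omega : 0 < q - 1) hζt h1
    refine ⟨k, hk, ?_⟩
    have h2 := congrArg (· ^ k) hx
    simp only [mul_pow, ← pow_mul, mul_comm _ k] at h2
    simp only [pow_mul, hθk, one_pow, mul_one] at h2
    exact h2.symm

end TorsionBinomial



/-- Lemma Gcd (ii). Let `z ≥ 2` and let `f ∈ ℂ[X_1, …, X_n]`, `n ≥ 2`,
be a nonzero polynomial of total degree `d ≥ 2`; set `t_0 = ⌈3 log d / log z⌉` and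
`c_0 = t_0 + d(d−1)`. Then there is an integer `t_1` with `t_0 ≤ t_1 ≤ c_0` such that
each irreducible common factor `g` of `f` and `f^{t_1} = f(X_1^{z^{t_1}}, …, X_n^{z^{t_1}})`
has the form `g = c (X^u − ζ X^v)`, a constant or monomial multiple of a binomial
`X^a − ζ`, where `ζ` is a root of unity with `ζ^{z^k (z^l − 1)} = 1` for some
`0 ≤ k, l ≤ c_0`. -/
theorem irreducible_common_factor_torsion_binomial
    (z n : ℕ) (hz : 2 ≤ z) (hn : 2 ≤ n)
    (f : MvPolynomial (Fin n) ℂ) (hf : f ≠ 0)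
    (d : ℕ) (hd : 2 ≤ d) (hdeg : f.totalDegree = d) :
    ∃ t₁ : ℕ,
      ⌈3 * Real.log d / Real.log z⌉₊ ≤ t₁ ∧
      t₁ ≤ ⌈3 * Real.log d / Real.log z⌉₊ + d * (d - 1) ∧
      ∀ g : MvPolynomial (Fin n) ℂ, Irreducible g → g ∣ f →
        g ∣ aeval (fun i => (X i : MvPolynomial (Fin n) ℂ) ^ z ^ t₁) f →
        ∃ (c : ℂ) (u v : Fin n →₀ ℕ) (ζ : ℂ) (k l : ℕ),
          c ≠ 0 ∧
          k ≤ ⌈3 * Real.log d / Real.log z⌉₊ + d * (d - 1) ∧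
          l ≤ ⌈3 * Real.log d / Real.log z⌉₊ + d * (d - 1) ∧
          (∃ m : ℕ, 0 < m ∧ ζ ^ m = 1) ∧
          ζ ^ (z ^ k * (z ^ l - 1)) = 1 ∧
          g = monomial u c - monomial v (c * ζ) := by
  classical
  set t₀ := ⌈3 * Real.log d / Real.log z⌉₊ with ht₀
  have ht₀pos : 0 < t₀ := by
    rw [ht₀, Nat.ceil_pos]
    have h1 : 0 < Real.log d := Real.log_pos (by exact_mod_cast hd)
    have h2 : 0 < Real.log z := Real.log_pos (by exact_mod_cast hz)
    positivity
  by_contra hcon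
  push Not at hcon
  -- every `t` is bad
  have hbad : ∀ t, t₀ ≤ t → t ≤ t₀ + d * (d - 1) → ∃ g : MvPolynomial (Fin n) ℂ,
      Irreducible g ∧ g ∣ f ∧ g ∣ expand (z ^ t) f ∧
      ¬ ∃ (c : ℂ) (u v : Fin n →₀ ℕ) (ζ : ℂ), c ≠ 0 ∧ (∃ m : ℕ, 0 < m ∧ ζ ^ m = 1) ∧
        g = monomial u c - monomial v (c * ζ) := by
    intro t h1 h2
    obtain ⟨g, hg, hgf, hgt, hno⟩ := hcon t h1 h2
    refine ⟨g, hg, hgf, hgt, ?_⟩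
    rintro ⟨c, u, v, ζ, hc, hm, hgeq⟩
    obtain ⟨m, hm0, hm1⟩ := hm
    exact hno c u v ζ 0 0 hc (Nat.zero_le _) (Nat.zero_le _) ⟨m, hm0, hm1⟩ (by simp) hgeq
  let F := UniqueFactorizationMonoid.factors f
  have hFirr : ∀ x ∈ F, Irreducible x := UniqueFactorizationMonoid.irreducible_of_factor
  have hFprod : Associated F.prod f := UniqueFactorizationMonoid.factors_prod hf
  let S := F.toFinset
  have hScard : S.card ≤ d := by
    have h1 := TorsionBinomial.totalDegree_prod_ge S id
      (fun x hx => hFirr x (Multiset.mem_toFinset.1 hx))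
    have h2 : ∏ x ∈ S, id x ∣ f := by
      refine dvd_trans ?_ hFprod.dvd
      rw [Finset.prod_eq_multiset_prod]
      simpa [S] using Multiset.prod_dvd_prod_of_le (Multiset.dedup_le F)
    rw [← hdeg]
    exact h1.trans (totalDegree_le_of_dvd_of_isDomain h2 hf)
  -- choose pairs of factors
  have hpair : ∀ t, t₀ ≤ t → t ≤ t₀ + d * (d - 1) → ∃ g g' h : MvPolynomial (Fin n) ℂ,
      Irreducible g ∧ g' ∈ S ∧ h ∈ S ∧ Associated g g' ∧ g ∣ expand (z ^ t) h ∧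
      ¬ ∃ (c : ℂ) (u v : Fin n →₀ ℕ) (ζ : ℂ), c ≠ 0 ∧ (∃ m : ℕ, 0 < m ∧ ζ ^ m = 1) ∧
        g = monomial u c - monomial v (c * ζ) := by
    intro t h1 h2
    obtain ⟨g, hg, hgf, hgt, hno⟩ := hbad t h1 h2
    obtain ⟨g', hg', hgg'⟩ := UniqueFactorizationMonoid.exists_mem_factors_of_dvd hf hg hgf
    have h3 : g ∣ (F.map (expand (z ^ t))).prod := by
      rw [← map_multiset_prod]
      exact hgt.trans (map_dvd _ hFprod.symm.dvd)
    obtain ⟨h, hh, hgh⟩ := hg.prime.exists_mem_multiset_map_dvd h3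
    exact ⟨g, g', h, hg, Multiset.mem_toFinset.2 hg', Multiset.mem_toFinset.2 hh, hgg', hgh, hno⟩
  choose! G G' H hG hG' hH hass hdvd hno using hpair
  have hSirr : ∀ x ∈ S, Irreducible x := fun x hx => hFirr x (Multiset.mem_toFinset.1 hx)
  have hzpow : ∀ t, 0 < t → 2 ≤ z ^ t := fun t ht =>
    hz.trans (Nat.le_self_pow ht.ne' z)
  have hoff : ∀ t ∈ Finset.Icc t₀ (t₀ + d * (d - 1)), (G' t, H t) ∈ S.offDiag := by
    intro t ht
    obtain ⟨h1, h2⟩ := Finset.mem_Icc.1 ht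
    rw [Finset.mem_offDiag]
    refine ⟨hG' t h1 h2, hH t h1 h2, ?_⟩
    intro heq
    simp only at heq
    have ha := hass t h1 h2
    rw [heq] at ha
    have hq := hzpow t (by omega)
    exact hno t h1 h2 (TorsionBinomial.core (by omega) hq (hG t h1 h2) (hSirr _ (hH t h1 h2))
      (ha.symm.dvd.trans (hdvd t h1 h2)) (hdvd t h1 h2))
  have hcard : S.offDiag.card < (Finset.Icc t₀ (t₀ + d * (d - 1))).card := by
    rw [Finset.offDiag_card, Nat.card_Icc]
    have h1 : S.card * S.card - S.card = S.card * (S.card - 1) := by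
      rw [Nat.mul_sub, mul_one]
    have h2 : S.card * (S.card - 1) ≤ d * (d - 1) := Nat.mul_le_mul hScard (by omega)
    omega
  obtain ⟨t, ht, t', ht', htt, heq⟩ := Finset.exists_ne_map_eq_of_card_lt_of_maps_to hcard hoff
  have final : ∀ t ∈ Finset.Icc t₀ (t₀ + d * (d - 1)), ∀ t' ∈ Finset.Icc t₀ (t₀ + d * (d - 1)),
      t < t' → (G' t, H t) = (G' t', H t') → False := by
    intro t ht t' ht' hlt heq
    obtain ⟨h1, h2⟩ := Finset.mem_Icc.1 ht
    obtain ⟨h1', h2'⟩ := Finset.mem_Icc.1 ht'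
    obtain ⟨e1, e2⟩ := Prod.mk.inj heq
    have ha : Associated (G t) (G t') := by
      refine (hass t h1 h2).trans ?_
      rw [e1]
      exact (hass t' h1' h2').symm
    have hd2 : G t ∣ expand (z ^ t) (expand (z ^ (t' - t)) (H t)) := by
      rw [← expand_mul, ← pow_add, Nat.add_sub_cancel' hlt.le, e2]
      exact ha.dvd.trans (hdvd t' h1' h2')
    have hzt := hzpow t (by omega)
    have hhh := TorsionBinomial.coprime_expand (by omega) (hG t h1 h2) (hSirr _ (hH t h1 h2))
      (hdvd t h1 h2) hd2
    exact hno t h1 h2 (TorsionBinomial.core (by omega) (hzpow (t' - t) (by omega)) (hG t h1 h2)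
      (hSirr _ (hH t h1 h2)) hhh (hdvd t h1 h2))
  rcases lt_or_gt_of_ne htt with h | h
  · exact final t ht t' ht' h heq
  · exact final t' ht' t ht h heq.symm
end

section
/- Let z ≥ 2 be an integer, let f ∈ ℂ[X] be a nonzero polynomial of degree d ≥ 1 in one variable, and let ω ∈ ℂ*. If f(ω^{z^t}) = 0 for all t = 0, 1, …, d, then there exist integers k ≥ 0 and l > 0 with k + l ≤ d such that ω^{z^{k+l}} = ω^{z^k}; consequently ω is a root of unity whose order divides z^k(z^l − 1), and f(ω^{z^t}) = 0 for all integers t ≥ 0. -/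
/-- one-variable base case. Let `z ≥ 2`, let `f ∈ ℂ[X]` be a nonzero
polynomial of degree `d ≥ 1`, and let `ω ∈ ℂ*`. If `f(ω^{z^t}) = 0` for all
`t = 0, 1, …, d`, then there are integers `k ≥ 0`, `l > 0` with `k + l ≤ d` such that
`ω^{z^{k+l}} = ω^{z^k}`; consequently `ω` is a root of unity whose order divides
`z^k (z^l − 1)`, and `f(ω^{z^t}) = 0` for all integers `t ≥ 0`. -/
theorem one_variable_stable_points
    (z : ℕ) (hz : 2 ≤ z) (f : Polynomial ℂ) (hf : f ≠ 0)
    (d : ℕ) (hd : 1 ≤ d) (hdeg : f.natDegree = d)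
    (ω : ℂ) (hω : ω ≠ 0)
    (h : ∀ t ≤ d, f.eval (ω ^ z ^ t) = 0) :
    ∃ k l : ℕ, 0 < l ∧ k + l ≤ d ∧
      ω ^ z ^ (k + l) = ω ^ z ^ k ∧
      ω ^ (z ^ k * (z ^ l - 1)) = 1 ∧
      ∀ t : ℕ, f.eval (ω ^ z ^ t) = 0 := by
  classical
  have key : ∃ a b : ℕ, a < b ∧ b ≤ d ∧ ω ^ z ^ a = ω ^ z ^ b := by
    have hcard : f.roots.toFinset.card < (Finset.range (d + 1)).card := by
      rw [Finset.card_range]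
      have h1 := Multiset.toFinset_card_le f.roots
      have h2 := Polynomial.card_roots' f
      omega
    obtain ⟨a, ha, b, hb, hab, he⟩ :=
      Finset.exists_ne_map_eq_of_card_lt_of_maps_to (f := fun t => ω ^ z ^ t) hcard (by
        intro t ht
        have ht' : t < d + 1 := by simpa using ht
        simp only [Finset.mem_coe, Multiset.mem_toFinset, Polynomial.mem_roots hf]
        exact h t (by omega))
    rw [Finset.mem_range] at ha hb
    rcases lt_or_gt_of_ne hab with hlt | hlt
    · exact ⟨a, b, hlt, by omega, he⟩
    · exact ⟨b, a, hlt, by omega, he.symm⟩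
  obtain ⟨k, b, hkb, hbd, he⟩ := key
  obtain ⟨l, rfl⟩ := Nat.exists_eq_add_of_lt hkb
  rw [add_assoc] at hbd he
  refine ⟨k, l + 1, by omega, hbd, he.symm, ?_, ?_⟩
  · have hp : 1 ≤ z ^ (l + 1) := Nat.one_le_pow _ _ (by omega)
    have hne : ω ^ z ^ k ≠ 0 := pow_ne_zero _ hω
    apply mul_right_cancel₀ hne
    rw [one_mul, ← pow_add, ← Nat.mul_succ, Nat.succ_eq_add_one, Nat.sub_add_cancel hp, ← pow_add]
    exact he.symm
  · intro t
    induction t using Nat.strong_induction_on with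
    | _ t ih =>
      by_cases ht : t ≤ d
      · exact h t ht
      · obtain ⟨s, rfl⟩ : ∃ s, t = k + (l + 1) + s := ⟨t - (k + (l + 1)), by omega⟩
        have := ih (k + s) (by omega)
        rw [pow_add z (k + (l + 1)) s, pow_mul, ← he, ← pow_mul, ← pow_add]
        exact this
end
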